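/- Let p and q be primes with p ≡ 5 (mod 8) and q ≡ 3 (mod 8), set d = pq, and let r ≥ 1 be the integer with 2^r = 2·h₂(-pq). Then for every integer n ≥ 1, the 2-class group of K_{n,d} is a cyclic group isomorphic to ℤ/2^{n+r-1}ℤ. -/

import Mathlib

open IntermediateField NumberField

/-- The quadratic field `ℚ(√m)` realized inside `ℂ` (for `m` of either sign). -/
noncomputable def quadField (m : ℤ) : IntermediateField ℚ ℂ :=
  IntermediateField.adjoin ℚ {z : ℂ | z ^ 2 = (m : ℂ)}

/-- The 2-class group of a number field `K ⊆ ℂ`: the 2-primary component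
(= 2-Sylow subgroup) of the ideal class group of its ring of integers. -/
noncomputable def twoClassGroup (K : IntermediateField ℚ ℂ) :
    Subgroup (ClassGroup (𝓞 K)) :=
  CommGroup.primaryComponent _ 2

/-- `h₂(m)`: the 2-class number of the quadratic field `ℚ(√m)`. -/
noncomputable def h2 (m : ℤ) : ℕ := Nat.card (twoClassGroup (quadField m))

/-- `L_{n,d} = ℚ(ζ_{2^{n+2}}, √d)`, the `n`-th layer of the cyclotomic
`ℤ₂`-extension of `ℚ(√d, √-1)`. -/
noncomputable def Lfield (n : ℕ) (d : ℤ) : IntermediateField ℚ ℂ :=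
  IntermediateField.adjoin ℚ
    ({z : ℂ | z ^ 2 ^ (n + 2) = 1} ∪ {z : ℂ | z ^ 2 = (d : ℂ)})

/-- `ℚ(ζ_{2^{n+2}} + ζ_{2^{n+2}}⁻¹, √d) = ℚ(2cos(2π/2^{n+2}), √d)`.
For `d > 0` this is the maximal real subfield `L_{n,d}⁺` of `L_{n,d}`;
for `d < 0` it is the `n`-th layer `K_{n,|d|}` of the cyclotomic
`ℤ₂`-extension of the imaginary quadratic field `ℚ(√d)`. -/
noncomputable def LplusField (n : ℕ) (d : ℤ) : IntermediateField ℚ ℂ :=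
  IntermediateField.adjoin ℚ
    ({((2 * Real.cos (2 * Real.pi / 2 ^ (n + 2)) : ℝ) : ℂ)} ∪ {z : ℂ | z ^ 2 = (d : ℂ)})

set_option linter.unusedSectionVars false
set_option linter.style.haveILetI false
set_option linter.unusedVariables false

open nonZeroDivisors

namespace TwoCl

section Abs
variable {A B : Type*} [CommRing A] [CommRing B] [IsDedekindDomain A] [IsDedekindDomain B]

/-- Map on class groups induced by an injective ring homomorphism of Dedekind domains. -/
noncomputable def clMap (f : A →+* B) (hf : Function.Injective f) :
    ClassGroup A →* ClassGroup B :=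
  letI := f.toAlgebra
  haveI : FaithfulSMul A B := (faithfulSMul_iff_algebraMap_injective A B).2 hf
  ClassGroup.extendedHom A B

theorem map_ne_bot (f : A →+* B) (hf : Function.Injective f) {I : Ideal A} (hI : I ≠ ⊥) :
    I.map f ≠ ⊥ := by
  rwa [Ne, Ideal.map_eq_bot_iff_of_injective hf]

/-- class of a nonzero ideal -/
noncomputable def cl (I : Ideal A) (hI : I ≠ ⊥) : ClassGroup A :=
  ClassGroup.mk0 ⟨I, mem_nonZeroDivisors_iff_ne_zero.2 hI⟩

theorem clMap_cl (f : A →+* B) (hf : Function.Injective f) (I : Ideal A) (hI : I ≠ ⊥) :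
    clMap f hf (cl I hI) = cl (I.map f) (map_ne_bot f hf hI) := by
  letI := f.toAlgebra
  haveI : FaithfulSMul A B := (faithfulSMul_iff_algebraMap_injective A B).2 hf
  exact ClassGroup.extendedHom_mk0 A B ⟨I, mem_nonZeroDivisors_iff_ne_zero.2 hI⟩

theorem cl_mul {I J : Ideal A} (hI : I ≠ ⊥) (hJ : J ≠ ⊥) :
    cl (I * J) (mul_ne_zero hI hJ) = cl I hI * cl J hJ := by
  rw [cl, cl, cl, ← map_mul]; rfl

theorem cl_surj (c : ClassGroup A) : ∃ (I : Ideal A) (hI : I ≠ ⊥), cl I hI = c := by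
  obtain ⟨I, rfl⟩ := ClassGroup.mk0_surjective c
  exact ⟨I.1, mem_nonZeroDivisors_iff_ne_zero.1 I.2, rfl⟩

theorem cl_congr {I J : Ideal A} (hI : I ≠ ⊥) (hIJ : I = J) :
    cl I hI = cl J (hIJ ▸ hI) := by subst hIJ; rfl

theorem cl_eq_iff {I J : Ideal A} (hI : I ≠ ⊥) (hJ : J ≠ ⊥) :
    cl I hI = cl J hJ ↔ ∃ x y : A, x ≠ 0 ∧ y ≠ 0 ∧ Ideal.span {x} * I = Ideal.span {y} * J := by
  rw [cl, cl, ClassGroup.mk0_eq_mk0_iff]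
  simp only [exists_prop]

theorem cl_eq_one_iff {I : Ideal A} (hI : I ≠ ⊥) :
    cl I hI = 1 ↔ ∃ x : A, x ≠ 0 ∧ I = Ideal.span {x} := by
  rw [cl, ClassGroup.mk0_eq_one_iff]
  constructor
  · rintro ⟨x, hx⟩
    refine ⟨x, ?_, hx⟩
    rintro rfl
    apply hI
    rw [hx]
    simp
  · rintro ⟨x, -, hx⟩
    exact ⟨x, hx⟩

theorem cl_span {x : A} (hx : x ≠ 0) :
    cl (Ideal.span {x}) (by simpa using hx) = 1 :=
  (cl_eq_one_iff _).2 ⟨x, hx, rfl⟩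

/-- parity lemma -/
theorem parity {M : Type*} [CommMonoidWithZero M] [IsCancelMulZero M] [WfDvdMonoid M] {π u v : M}
    (hπ : Prime π) (hu : ¬ π ∣ u) (hv : ¬ π ∣ v) {x y : M} (hx : x ≠ 0)
    (h : π * u * x ^ 2 = v * y ^ 2) : False := by
  have hu0 : u ≠ 0 := by rintro rfl; simp at hu
  have hv0 : v ≠ 0 := by rintro rfl; simp at hv
  have hy : y ≠ 0 := by
    rintro rfl
    have : π * u * x ^ 2 ≠ 0 := mul_ne_zero (mul_ne_zero hπ.ne_zero hu0) (pow_ne_zero _ hx)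
    apply this; rw [h]; simp
  have fx := FiniteMultiplicity.of_not_isUnit hπ.not_isUnit hx
  have fy := FiniteMultiplicity.of_not_isUnit hπ.not_isUnit hy
  have e1 : emultiplicity π (π * u * x ^ 2) = 1 + 2 * emultiplicity π x := by
    rw [emultiplicity_mul hπ, emultiplicity_mul hπ, emultiplicity_pow hπ,
      emultiplicity_eq_zero.2 hu]
    have : emultiplicity π π = 1 := by
      have := (FiniteMultiplicity.of_not_isUnit hπ.not_isUnit hπ.ne_zero).emultiplicity_self
      exact this
    rw [this]; simp
  have e2 : emultiplicity π (v * y ^ 2) = 2 * emultiplicity π y := by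
    rw [emultiplicity_mul hπ, emultiplicity_pow hπ, emultiplicity_eq_zero.2 hv]
    simp
  rw [h, e2, fx.emultiplicity_eq_multiplicity, fy.emultiplicity_eq_multiplicity] at e1
  have : 2 * multiplicity π y = 1 + 2 * multiplicity π x := by exact_mod_cast e1
  omega

end Abs

section S
variable {B : Type*} [CommRing B] [IsDedekindDomain B]

theorem inj_coe (s : B ≃+* B) : Function.Injective (s : B →+* B) := s.injective

/-- the automorphism of the class group induced by a ring automorphism -/
noncomputable def sCl (s : B ≃+* B) : ClassGroup B →* ClassGroup B :=
  clMap (s : B →+* B) (inj_coe s)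

theorem map_equiv_ne_bot (s : B ≃+* B) {I : Ideal B} (hI : I ≠ ⊥) : I.map s ≠ ⊥ :=
  map_ne_bot (s : B →+* B) (inj_coe s) hI

theorem sCl_cl (s : B ≃+* B) (I : Ideal B) (hI : I ≠ ⊥) :
    sCl s (cl I hI) = cl (I.map s) (map_equiv_ne_bot s hI) :=
  clMap_cl (s : B →+* B) (inj_coe s) I hI

end S

section Q
variable {A B : Type*} [CommRing A] [CommRing B] [IsDedekindDomain A] [IsDedekindDomain B]
  [Module.Free ℤ A] [Module.Finite ℤ A] [Module.Free ℤ B] [Module.Finite ℤ B]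

/-- Quadratic extension data at the level of rings of integers. -/
structure QD (i : A →+* B) (s : B ≃+* B) : Prop where
  inj : Function.Injective i
  fix : ∀ a, s (i a) = i a
  inv : ∀ b, s (s b) = b
  mem : ∀ b, s b = b → ∃ a, i a = b
  nontriv : ∃ c : B, c ≠ 0 ∧ s c = - c
  norm : ∀ I : Ideal A, Ideal.absNorm (I.map i) = Ideal.absNorm I ^ 2

variable {i : A →+* B} {s : B ≃+* B}

namespace QD

theorem map_map_s (h : QD i s) (I : Ideal B) : (I.map s).map s = I := by
  have : (I.map s).map s = (I.map (s : B →+* B)).map (s : B →+* B) := rfl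
  rw [this, Ideal.map_map]
  have : (s : B →+* B).comp (s : B →+* B) = RingHom.id B := RingHom.ext fun b => h.inv b
  rw [this, Ideal.map_id]

theorem map_i_s (h : QD i s) (J : Ideal A) : (J.map i).map s = J.map i := by
  have : (J.map i).map s = (J.map i).map (s : B →+* B) := rfl
  rw [this, Ideal.map_map]
  congr 1
  exact RingHom.ext fun b => h.fix b

theorem mem_map_s (h : QD i s) {I : Ideal B} {x : B} : x ∈ I.map s ↔ s x ∈ I := by
  rw [Ideal.mem_map_iff_of_surjective s s.surjective]
  constructor
  · rintro ⟨y, hy, rfl⟩; rwa [h.inv]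
  · intro hx; exact ⟨s x, hx, h.inv x⟩

theorem map_s_ne_bot (h : QD i s) {I : Ideal B} (hI : I ≠ ⊥) : I.map s ≠ ⊥ :=
  map_ne_bot (s : B →+* B) s.injective hI

theorem absNorm_map_s (h : QD i s) (I : Ideal B) : (I.map s).absNorm = I.absNorm := by
  rw [Ideal.absNorm_apply, Ideal.absNorm_apply, Submodule.cardQuot_apply, Submodule.cardQuot_apply]
  exact (Nat.card_congr (Ideal.quotientEquiv I (I.map s) s rfl).toEquiv).symm

theorem eq_of_le_of_absNorm {R : Type*} [CommRing R] [IsDedekindDomain R] [Module.Free ℤ R]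
    [Module.Finite ℤ R]
    {I J : Ideal R} (hI : I ≠ ⊥) (hle : I ≤ J) (hn : I.absNorm = J.absNorm) : I = J := by
  obtain ⟨K, hK⟩ := Ideal.dvd_iff_le.2 hle
  have h0 : J.absNorm ≠ 0 := by
    rw [← hn, Ne, Ideal.absNorm_eq_zero_iff]; exact hI
  have : K.absNorm = 1 := by
    rw [hK, map_mul] at hn
    exact Nat.eq_of_mul_eq_mul_left (Nat.pos_of_ne_zero h0) (by omega)
  rw [Ideal.absNorm_eq_one_iff] at this
  rw [hK, this, Ideal.mul_top]

theorem map_i_injective (h : QD i s) {I J : Ideal A} (hI : I ≠ ⊥) (hIJ : I.map i = J.map i) : I = J := by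
  have key : ∀ {I J : Ideal A}, I ≠ ⊥ → I.map i = J.map i → I = I ⊔ J := by
    intro I J hI hIJ
    apply eq_of_le_of_absNorm hI le_sup_left
    have e : (I ⊔ J).map i = I.map i := by rw [Ideal.map_sup, ← hIJ, sup_idem]
    have h1 := h.norm I
    have h2 := h.norm (I ⊔ J)
    rw [e, h1] at h2
    exact Nat.pow_left_injective (n := 2) (by norm_num) h2
  have hJ : J ≠ ⊥ := by
    rintro rfl
    exact map_ne_bot i h.inj hI (by rw [hIJ]; simp)
  rw [key hI hIJ]
  conv_rhs => rw [key hJ hIJ.symm]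
  exact sup_comm _ _

/-- The prime below. -/
theorem comap_ne_bot (h : QD i s) {P : Ideal B} (hP : P ≠ ⊥) : P.comap i ≠ ⊥ := by
  intro h0
  obtain ⟨x, hx, hx0⟩ := Submodule.exists_mem_ne_zero_of_ne_bot hP
  obtain ⟨a, ha⟩ := h.mem (x * s x) (by rw [map_mul, h.inv, mul_comm])
  have : a ∈ P.comap i := by
    rw [Ideal.mem_comap, ha]; exact Ideal.mul_mem_right _ _ hx
  rw [h0] at this
  have ha0 : a = 0 := this
  rw [ha0, map_zero] at ha
  rcases mul_eq_zero.1 ha.symm with h1 | h1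
  · exact hx0 h1
  · exact hx0 (by simpa using h1)

theorem card_le (h : QD i s) {P : Ideal B} (hP : P ≠ ⊥) : (P.comap i).absNorm ≤ P.absNorm := by
  rw [Ideal.absNorm_apply, Ideal.absNorm_apply, Submodule.cardQuot_apply, Submodule.cardQuot_apply]
  haveI : Finite (B ⧸ P) := by
    rw [← Ideal.absNorm_ne_zero_iff, Ne, Ideal.absNorm_eq_zero_iff]; exact hP
  exact Nat.card_le_card_of_injective (Ideal.quotientMap P i le_rfl)
    (Ideal.quotientMap_injective)

/-- ramified primes -/
def Ram (_ : QD i s) (P : Ideal B) : Prop :=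
  P.IsPrime ∧ P ≠ ⊥ ∧ P.map s = P ∧ P ^ 2 = (P.comap i).map i ∧ ∀ x, s x - x ∈ P

theorem trichotomy (h : QD i s) {P : Ideal B} (hP : P.IsPrime) (hP0 : P ≠ ⊥) :
    (P.map s ≠ P ∧ P * P.map s = (P.comap i).map i) ∨ (P.map s = P ∧ P = (P.comap i).map i) ∨
      h.Ram P := by
  set p := P.comap i with hp
  have hp0 : p ≠ ⊥ := h.comap_ne_bot hP0
  have hpB0 : p.map i ≠ ⊥ := map_ne_bot i h.inj hp0
  have hle : p.map i ≤ P := Ideal.map_comap_le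
  have hq : 0 < p.absNorm := Nat.pos_of_ne_zero (by rwa [Ne, Ideal.absNorm_eq_zero_iff])
  have hPn : p.absNorm ≤ P.absNorm := h.card_le hP0
  have hsP : (P.map s).IsPrime := Ideal.map_isPrime_of_equiv s
  have hPprime := Ideal.prime_of_isPrime hP0 hP
  have hN := h.norm p
  by_cases hs : P.map s = P
  · right
    obtain ⟨R, hR⟩ := Ideal.dvd_iff_le.2 hle
    have hR0 : R ≠ ⊥ := by rintro rfl; simp at hR; exact hpB0 hR
    by_cases hR1 : R = ⊤
    · left; refine ⟨hs, ?_⟩; rw [hR, hR1, Ideal.mul_top]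
    right
    obtain ⟨Q, hQm, hQ⟩ := Ideal.exists_le_maximal R hR1
    have hQ0 : Q ≠ ⊥ := by rintro rfl; exact hR0 (le_bot_iff.1 hQ)
    have hQp : Q.comap i = p := by
      have hmax : p.IsMaximal := (hP.comap i).isMaximal hp0
      refine (hmax.eq_of_le ?_ ?_).symm
      · exact (hQm.isPrime.comap i).ne_top
      · rw [← Ideal.map_le_iff_le_comap, hR]; exact Ideal.mul_le_right.trans hQ
    have hQn := h.card_le hQ0
    rw [hQp] at hQn
    have hQR : R.absNorm ≥ Q.absNorm := by
      refine Nat.le_of_dvd ?_ (Ideal.absNorm_dvd_absNorm_of_le hQ)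
      exact Nat.pos_of_ne_zero (by rwa [Ne, Ideal.absNorm_eq_zero_iff])
    rw [hR, map_mul] at hN
    have hPq : P.absNorm = p.absNorm := by
      have : P.absNorm * p.absNorm ≤ p.absNorm * p.absNorm := by
        rw [← sq, ← hN]; exact Nat.mul_le_mul_left _ (hQn.trans hQR)
      have := Nat.le_of_mul_le_mul_right this hq
      omega
    have hRq : R.absNorm = p.absNorm := by
      rw [hPq, sq] at hN; exact Nat.eq_of_mul_eq_mul_left hq hN
    have hRQ : R = Q := eq_of_le_of_absNorm hR0 hQ (by omega)
    have hsQ : Q.map s = Q := by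
      have e := h.map_i_s p
      rw [hR, Ideal.map_mul, hs, hRQ] at e
      exact mul_left_cancel₀ hP0 e
    have hPQ : P = Q := by
      have hmaxP : P.IsMaximal := hP.isMaximal hP0
      refine hmaxP.eq_of_le hQm.ne_top ?_
      intro x hx
      obtain ⟨a, ha⟩ := h.mem (x * s x) (by rw [map_mul, h.inv, mul_comm])
      have hap : a ∈ p := by
        rw [hp, Ideal.mem_comap, ha]; exact Ideal.mul_mem_right _ _ hx
      rw [← hQp, Ideal.mem_comap, ha] at hap
      rcases hQm.isPrime.mem_or_mem hap with h1 | h1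
      · exact h1
      · rw [← hsQ, h.mem_map_s]; exact h1
    refine ⟨hP, hP0, hs, ?_, ?_⟩
    · rw [← hp, hR, hRQ, ← hPQ, sq]
    · intro x
      haveI : Finite (B ⧸ P) := by
        rw [← Ideal.absNorm_ne_zero_iff, Ne, Ideal.absNorm_eq_zero_iff]; exact hP0
      have hbij : Function.Bijective (Ideal.quotientMap P i (le_refl (P.comap i))) := by
        apply Function.Injective.bijective_of_nat_card_le
        · exact Ideal.quotientMap_injective
        · rw [Ideal.absNorm_apply, Ideal.absNorm_apply, Submodule.cardQuot_apply,
            Submodule.cardQuot_apply] at hPq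
          exact hPq.le
      obtain ⟨a, ha⟩ := hbij.2 (Ideal.Quotient.mk P x)
      obtain ⟨a, rfl⟩ := Ideal.Quotient.mk_surjective a
      rw [Ideal.quotientMap_mk, Ideal.Quotient.eq] at ha
      have h2 : s (i a - x) ∈ P := by
        rw [← h.mem_map_s, hs]; exact ha
      rw [map_sub, h.fix] at h2
      have := P.sub_mem ha h2
      convert this using 1; ring
  · left
    refine ⟨hs, ?_⟩
    have hsle : p.map i ≤ P.map s := by
      rw [← h.map_i_s p]; exact Ideal.map_mono hle
    have hmul : P * P.map s ∣ p.map i := by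
      obtain ⟨R, hR⟩ := Ideal.dvd_iff_le.2 hle
      have hd : P.map s ∣ P * R := by rw [← hR]; exact Ideal.dvd_iff_le.2 hsle
      have hsPp := Ideal.prime_of_isPrime (h.map_s_ne_bot hP0) hsP
      rcases hsPp.dvd_or_dvd hd with h1 | h1
      · exfalso
        apply hs
        have hm : P.IsMaximal := hP.isMaximal hP0
        exact (hm.eq_of_le hsP.ne_top (Ideal.dvd_iff_le.1 h1)).symm
      · rw [hR]; exact mul_dvd_mul_left _ h1
    refine (eq_of_le_of_absNorm hpB0 (Ideal.dvd_iff_le.1 hmul) ?_).symm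
    apply le_antisymm
    · rw [map_mul, h.absNorm_map_s, hN, sq]; exact Nat.mul_le_mul hPn hPn
    · refine Nat.le_of_dvd ?_ (Ideal.absNorm_dvd_absNorm_of_le (Ideal.dvd_iff_le.1 hmul))
      exact Nat.pos_of_ne_zero (by rwa [Ne, Ideal.absNorm_eq_zero_iff])

theorem exists_norm (h : QD i s) {I : Ideal B} (hI : I ≠ ⊥) : ∃ J : Ideal A, J ≠ ⊥ ∧ I * I.map s = J.map i := by
  revert hI
  refine UniqueFactorizationMonoid.induction_on_prime I (fun h0 => absurd rfl h0) ?_ ?_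
  · intro x hx _
    rw [Ideal.isUnit_iff] at hx
    refine ⟨⊤, top_ne_bot, ?_⟩
    rw [hx, Ideal.map_top, Ideal.map_top, Ideal.mul_top]
  · intro I P hI hP ih _
    obtain ⟨J, hJ, e⟩ := ih hI
    have hPp := Ideal.isPrime_of_prime hP
    have hp0 := h.comap_ne_bot hP.ne_zero
    have e2 : P * I * (P * I).map s = (P * P.map s) * (I * I.map s) := by
      rw [Ideal.map_mul]; ring
    rw [e2, e]
    rcases h.trichotomy hPp hP.ne_zero with h1 | h1 | h1
    · refine ⟨P.comap i * J, mul_ne_zero hp0 hJ, ?_⟩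
      rw [Ideal.map_mul, h1.2]
    · refine ⟨P.comap i ^ 2 * J, mul_ne_zero (pow_ne_zero _ hp0) hJ, ?_⟩
      rw [Ideal.map_mul, Ideal.map_pow, h1.1, ← h1.2, sq]
    · refine ⟨P.comap i * J, mul_ne_zero hp0 hJ, ?_⟩
      rw [Ideal.map_mul, h1.2.2.1, ← h1.2.2.2.1, sq]

/-- generators of the ambiguous ideals -/
def gens (h : QD i s) : Set (Ideal B) := {I | ∃ J : Ideal A, J ≠ ⊥ ∧ I = J.map i} ∪ {P | h.Ram P}

theorem ambiguous (h : QD i s) {I : Ideal B} (hI : I ≠ ⊥) (hs : I.map s = I) :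
    I ∈ Submonoid.closure h.gens := by
  have H : ∀ n : ℕ, ∀ I : Ideal B, I ≠ ⊥ → I.map s = I → I.absNorm = n →
      I ∈ Submonoid.closure h.gens := by
    intro n
    induction n using Nat.strong_induction_on with
    | _ n ih =>
    intro I hI hs hn
    by_cases hI1 : I = ⊤
    · rw [hI1, ← Ideal.one_eq_top]; exact one_mem _
    obtain ⟨P, hPm, hle⟩ := Ideal.exists_le_maximal I hI1
    have hP0 : P ≠ ⊥ := by rintro rfl; exact hI (le_bot_iff.1 hle)
    have hp0 := h.comap_ne_bot hP0
    have hP := hPm.isPrime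
    have fin : ∀ G : Ideal B, G ∈ h.gens → G ≤ P → G.map s = G → G ∣ I →
        I ∈ Submonoid.closure h.gens := by
      rintro G hG hGP hGs ⟨R, hR⟩
      have hG0 : G ≠ ⊥ := by rintro rfl; simp at hR; exact hI hR
      have hR0 : R ≠ ⊥ := by rintro rfl; simp at hR; exact hI hR
      rw [hR]
      refine mul_mem (Submonoid.subset_closure hG) (ih R.absNorm ?_ R hR0 ?_ rfl)
      · rw [← hn, hR, map_mul]
        have h1 : 0 < R.absNorm := Nat.pos_of_ne_zero (by rwa [Ne, Ideal.absNorm_eq_zero_iff])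
        have h2 : G.absNorm ≠ 0 := by rwa [Ne, Ideal.absNorm_eq_zero_iff]
        have h3 : G.absNorm ≠ 1 := by
          rw [Ne, Ideal.absNorm_eq_one_iff]; rintro rfl
          exact hPm.ne_top (top_le_iff.1 hGP)
        have : 2 ≤ G.absNorm := by omega
        nlinarith
      · rw [hR, Ideal.map_mul, hGs] at hs
        exact mul_left_cancel₀ hG0 hs
    rcases h.trichotomy hP hP0 with h1 | h1 | h1
    · refine fin ((P.comap i).map i) (Or.inl ⟨_, hp0, rfl⟩) Ideal.map_comap_le (h.map_i_s _) ?_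
      rw [← h1.2]
      obtain ⟨R, hR⟩ := Ideal.dvd_iff_le.2 hle
      have hsP : (P.map s).IsPrime := Ideal.map_isPrime_of_equiv s
      have hd : P.map s ∣ P * R := by
        rw [← hR, ← hs]; exact Ideal.dvd_iff_le.2 (Ideal.map_mono hle)
      rcases (Ideal.prime_of_isPrime (h.map_s_ne_bot hP0) hsP).dvd_or_dvd hd with h2 | h2
      · exact absurd (hPm.eq_of_le hsP.ne_top (Ideal.dvd_iff_le.1 h2)).symm h1.1
      · rw [hR]; exact mul_dvd_mul_left _ h2
    · refine fin P (Or.inl ⟨_, hp0, h1.2⟩) le_rfl h1.1 (Ideal.dvd_iff_le.2 hle)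
    · refine fin P (Or.inr h1) le_rfl h1.2.2.1 (Ideal.dvd_iff_le.2 hle)
  exact H _ I hI hs rfl

theorem hilbert90 (h : QD i s) {a b : B} (ha : a ≠ 0) (hb : b ≠ 0) (hab : a * s a = b * s b) :
    ∃ β : B, β ≠ 0 ∧ s β * a = β * b := by
  have hsb : s b ≠ 0 := by simpa using hb
  by_cases hc : b + a = 0
  · obtain ⟨c, hc0, hc1⟩ := h.nontriv
    refine ⟨c, hc0, ?_⟩
    rw [hc1]; linear_combination c * (-hc)
  · refine ⟨(b + a) * s b, mul_ne_zero hc hsb, ?_⟩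
    simp only [map_mul, map_add, h.inv]
    linear_combination b * hab

/-- `j` and the involution on class groups -/
theorem cl_mul_s (h : QD i s) (c : ClassGroup B) :
    ∃ d : ClassGroup A, c * sCl s c = clMap i h.inj d := by
  obtain ⟨I, hI, rfl⟩ := cl_surj c
  obtain ⟨J, hJ, e⟩ := h.exists_norm hI
  refine ⟨cl J hJ, ?_⟩
  rw [clMap_cl, sCl_cl, ← cl_mul]
  exact cl_congr _ e

theorem s_j (h : QD i s) (d : ClassGroup A) :
    sCl s (clMap i h.inj d) = clMap i h.inj d := by
  obtain ⟨J, hJ, rfl⟩ := cl_surj d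
  rw [clMap_cl, sCl_cl]
  exact cl_congr _ (h.map_i_s J)

/-- subgroup of ambiguous classes represented by ambiguous ideals -/
noncomputable def strong (h : QD i s) : Subgroup (ClassGroup B) :=
  (clMap i h.inj).range ⊔ Subgroup.closure {c | ∃ (P : Ideal B) (hP : h.Ram P), c = cl P hP.2.1}

theorem mem_strong (h : QD i s) {I : Ideal B} (hI : I ≠ ⊥) (hs : I.map s = I) : cl I hI ∈ h.strong := by
  have H := h.ambiguous hI hs
  have : ∃ hI : I ≠ ⊥, cl I hI ∈ h.strong := by
    clear hI hs
    induction H using Submonoid.closure_induction with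
    | mem x hx =>
      rcases hx with ⟨J, hJ, rfl⟩ | hx
      · refine ⟨map_ne_bot i h.inj hJ, ?_⟩
        rw [← clMap_cl i h.inj J hJ]
        exact Subgroup.mem_sup_left ⟨_, rfl⟩
      · exact ⟨hx.2.1, Subgroup.mem_sup_right (Subgroup.subset_closure ⟨x, hx, rfl⟩)⟩
    | one =>
      refine ⟨one_ne_zero, ?_⟩
      have : cl (1 : Ideal B) one_ne_zero = 1 := by rw [cl]; exact map_one _
      rw [this]; exact one_mem _
    | mul x y _ _ hx hy =>
      obtain ⟨hx0, hx⟩ := hx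
      obtain ⟨hy0, hy⟩ := hy
      exact ⟨mul_ne_zero hx0 hy0, by rw [cl_mul hx0 hy0]; exact mul_mem hx hy⟩
  exact this.2

theorem fixed_mem_strong (h : QD i s)
    (hU : ∀ ε : Aˣ, (∃ a b : B, b ≠ 0 ∧ a * s a = i ε * (b * s b)) → ∃ u : Bˣ, u * s u = i ε)
    {c : ClassGroup B} (hc : sCl s c = c) : c ∈ h.strong := by
  obtain ⟨I, hI, rfl⟩ := cl_surj c
  rw [sCl_cl, cl_eq_iff] at hc
  obtain ⟨b, a, hb, ha, e⟩ := hc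
  have hsa : s a ≠ 0 := by simpa using ha
  have hsb : s b ≠ 0 := by simpa using hb
  have e' : Ideal.span {b} * I.map s = Ideal.span {a} * I := e
  have e2 : Ideal.span {s b} * I = Ideal.span {s a} * I.map s := by
    have := congrArg (Ideal.map s) e'
    rwa [Ideal.map_mul, Ideal.map_mul, h.map_map_s, Ideal.map_span, Ideal.map_span,
      Set.image_singleton, Set.image_singleton] at this
  have hsp : Ideal.span {b * s b} = Ideal.span {a * s a} := by
    rw [← Ideal.span_singleton_mul_span_singleton, ← Ideal.span_singleton_mul_span_singleton]
    have : Ideal.span {b} * Ideal.span {s b} * I = Ideal.span {a} * Ideal.span {s a} * I := by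
      rw [mul_assoc, e2, mul_left_comm, e']; ring
    exact mul_right_cancel₀ hI this
  obtain ⟨ε, hε⟩ := Ideal.span_singleton_eq_span_singleton.1 hsp
  have hbb : b * s b ≠ 0 := mul_ne_zero hb hsb
  have hsε : s (ε : B) = ε := by
    have h1 : s (b * s b * ε) = b * s b * ε := by rw [hε, map_mul, h.inv, mul_comm]
    rw [map_mul, map_mul, h.inv, mul_comm (s b)] at h1
    exact mul_left_cancel₀ hbb h1
  have hsε' : s ((ε⁻¹ : Bˣ) : B) = (ε⁻¹ : Bˣ) := by
    have h1 : s ((ε : B) * ((ε⁻¹ : Bˣ) : B)) = 1 := by rw [Units.mul_inv, map_one]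
    rw [map_mul, hsε] at h1
    exact (Units.inv_eq_of_mul_eq_one_right h1).symm
  obtain ⟨u, hu⟩ := h.mem _ hsε
  obtain ⟨v, hv⟩ := h.mem _ hsε'
  have huv : u * v = 1 := h.inj (by rw [map_mul, hu, hv, Units.mul_inv, map_one])
  obtain ⟨w, hw⟩ := hU (Units.mkOfMulEqOne u v huv) ⟨a, b, hb, by
    rw [Units.val_mkOfMulEqOne, hu, ← hε]; ring⟩
  rw [Units.val_mkOfMulEqOne, hu] at hw
  have hw0 : (w : B) ≠ 0 := w.ne_zero
  obtain ⟨β, hβ, hβ'⟩ := h.hilbert90 (a := a) (b := b * w) ha (mul_ne_zero hb hw0) (by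
    rw [← hε, map_mul, ← hw]; ring)
  have hamb : (Ideal.span {β} * I).map s = Ideal.span {β} * I := by
    rw [Ideal.map_mul, Ideal.map_span, Set.image_singleton]
    have hbI : Ideal.span {b} ≠ ⊥ := by simpa using hb
    apply mul_left_cancel₀ hbI
    have hspan : Ideal.span {s β} * Ideal.span {a} = Ideal.span {β} * Ideal.span {b} := by
      rw [Ideal.span_singleton_mul_span_singleton, Ideal.span_singleton_mul_span_singleton, hβ',
        Ideal.span_singleton_eq_span_singleton]
      exact ⟨w⁻¹, by rw [mul_assoc, mul_assoc, Units.mul_inv, mul_one]⟩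
    calc Ideal.span {b} * (Ideal.span {s β} * I.map s)
        = Ideal.span {s β} * (Ideal.span {b} * I.map s) := by ring
      _ = Ideal.span {s β} * Ideal.span {a} * I := by rw [e']; ring
      _ = _ := by rw [hspan]; ring
  have hβI : Ideal.span {β} ≠ ⊥ := by simpa using hβ
  have := h.mem_strong (mul_ne_zero hβI hI) hamb
  rwa [cl_mul hβI hI, cl_span hβ, one_mul] at this

end QD
end Q
end TwoCl

set_option linter.unusedSectionVars false
set_option linter.style.haveILetI false
set_option linter.unusedVariables false

open IntermediateField NumberField

namespace TwoCl

/-- Complex value of an algebraic integer of `E`. -/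
noncomputable def v {E : IntermediateField ℚ ℂ} : 𝓞 E →+* ℂ :=
  (algebraMap E ℂ).comp (algebraMap (𝓞 E) E)

theorem v_apply {E : IntermediateField ℚ ℂ} (x : 𝓞 E) : v x = ((x : E) : ℂ) := rfl

theorem v_inj {E : IntermediateField ℚ ℂ} : Function.Injective (v (E := E)) := by
  intro x y h
  exact RingOfIntegers.ext (Subtype.ext h)

theorem v_mem {E : IntermediateField ℚ ℂ} (x : 𝓞 E) : v x ∈ E := (x : E).2

theorem v_int {E : IntermediateField ℚ ℂ} (x : 𝓞 E) : IsIntegral ℤ (v x) :=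
  (RingOfIntegers.isIntegral x).map (v.toIntAlgHom)

theorem exists_v {E : IntermediateField ℚ ℂ} {z : ℂ} (hz : z ∈ E) (hi : IsIntegral ℤ z) :
    ∃ x : 𝓞 E, v x = z := by
  have h : IsIntegral ℤ (⟨z, hz⟩ : E) := by
    rw [← isIntegral_algebraMap_iff (algebraMap E ℂ).injective (A := E) (B := ℂ)]
    exact hi
  exact ⟨⟨_, h⟩, rfl⟩

/-- inclusion of rings of integers -/
noncomputable def incl {E E' : IntermediateField ℚ ℂ} (h : E ≤ E') : 𝓞 E →+* 𝓞 E' :=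
  RingOfIntegers.mapRingHom (IntermediateField.inclusion h).toRingHom

@[simp] theorem v_incl {E E' : IntermediateField ℚ ℂ} (h : E ≤ E') (x : 𝓞 E) :
    v (incl h x) = v x := rfl

/-- `E + E s` for `s ^ 2 ∈ E`. -/
noncomputable def adj (E : IntermediateField ℚ ℂ) (s : ℂ) (hs : s ^ 2 ∈ E) :
    IntermediateField ℚ ℂ :=
  Subalgebra.toIntermediateField
    { carrier := {z | ∃ a ∈ E, ∃ b ∈ E, z = a + b * s}
      mul_mem' := by
        rintro _ _ ⟨a, ha, b, hb, rfl⟩ ⟨a', ha', b', hb', rfl⟩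
        exact ⟨a * a' + b * b' * s ^ 2, add_mem (mul_mem ha ha') (mul_mem (mul_mem hb hb') hs),
          a * b' + a' * b, add_mem (mul_mem ha hb') (mul_mem ha' hb), by ring⟩
      add_mem' := by
        rintro _ _ ⟨a, ha, b, hb, rfl⟩ ⟨a', ha', b', hb', rfl⟩
        exact ⟨a + a', add_mem ha ha', b + b', add_mem hb hb', by ring⟩
      algebraMap_mem' := fun r => ⟨algebraMap ℚ ℂ r, E.algebraMap_mem r, 0, E.zero_mem, by simp⟩ }
    (by
      rintro _ ⟨a, ha, b, hb, rfl⟩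
      by_cases h : a - b * s = 0
      · refine ⟨(2 * a)⁻¹, E.inv_mem (mul_mem (E.natCast_mem 2) ha), 0, E.zero_mem, ?_⟩
        have : b * s = a := by linear_combination -h
        rw [this]; ring
      · by_cases h' : a + b * s = 0
        · exact ⟨0, E.zero_mem, 0, E.zero_mem, by rw [h']; simp⟩
        have hD : a ^ 2 - b ^ 2 * s ^ 2 ∈ E := sub_mem (pow_mem ha 2) (mul_mem (pow_mem hb 2) hs)
        have hD0 : a ^ 2 - b ^ 2 * s ^ 2 ≠ 0 := by
          have := mul_ne_zero h h'
          intro h0; apply this; linear_combination h0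
        refine ⟨a / (a ^ 2 - b ^ 2 * s ^ 2), div_mem ha hD, - b / (a ^ 2 - b ^ 2 * s ^ 2),
          div_mem (neg_mem hb) hD, ?_⟩
        field_simp
        ring)

theorem mem_adj {E : IntermediateField ℚ ℂ} {s : ℂ} {hs : s ^ 2 ∈ E} {z : ℂ} :
    z ∈ adj E s hs ↔ ∃ a ∈ E, ∃ b ∈ E, z = a + b * s := Iff.rfl

theorem le_adj {E : IntermediateField ℚ ℂ} {s : ℂ} {hs : s ^ 2 ∈ E} : E ≤ adj E s hs :=
  fun z hz => ⟨z, hz, 0, E.zero_mem, by simp⟩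

theorem s_mem_adj {E : IntermediateField ℚ ℂ} {s : ℂ} {hs : s ^ 2 ∈ E} : s ∈ adj E s hs :=
  ⟨0, E.zero_mem, 1, E.one_mem, by simp⟩

theorem uniq {E : IntermediateField ℚ ℂ} {s : ℂ} (hsE : s ∉ E) {a b a' b' : ℂ} (ha : a ∈ E)
    (hb : b ∈ E) (ha' : a' ∈ E) (hb' : b' ∈ E) (h : a + b * s = a' + b' * s) :
    a = a' ∧ b = b' := by
  have hbb : b = b' := by
    by_contra hne
    apply hsE
    have h1 : b - b' ≠ 0 := sub_ne_zero.2 hne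
    have : s = (a' - a) / (b - b') := by
      rw [eq_div_iff h1]; linear_combination h
    rw [this]; exact div_mem (sub_mem ha' ha) (sub_mem hb hb')
  subst hbb
  exact ⟨by linear_combination h, rfl⟩

/-- A quadratic step. -/
structure Step (E E' : IntermediateField ℚ ℂ) (s : ℂ) : Prop where
  le : E ≤ E'
  sq : s ^ 2 ∈ E
  mem : s ∈ E'
  notMem : s ∉ E
  ex : ∀ z ∈ E', ∃ a ∈ E, ∃ b ∈ E, z = a + b * s

theorem step_adj {E : IntermediateField ℚ ℂ} {s : ℂ} {hs : s ^ 2 ∈ E} (h : s ∉ E) :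
    Step E (adj E s hs) s := ⟨le_adj, hs, s_mem_adj, h, fun _ hz => hz⟩

namespace Step
variable {E E' : IntermediateField ℚ ℂ} {s : ℂ}

theorem ex' (h : Step E E' s) (z : E') : ∃ p : ℂ × ℂ, p.1 ∈ E ∧ p.2 ∈ E ∧ (z : ℂ) = p.1 + p.2 * s := by
  obtain ⟨a, ha, b, hb, e⟩ := h.ex z z.2
  exact ⟨(a, b), ha, hb, e⟩

/-- conjugation as a function -/
noncomputable def fn (h : Step E E' s) (z : E') : E' :=
  ⟨(h.ex' z).choose.1 - (h.ex' z).choose.2 * s,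
    sub_mem (h.le (h.ex' z).choose_spec.1) (mul_mem (h.le (h.ex' z).choose_spec.2.1) h.mem)⟩

theorem fn_eq (h : Step E E' s) {z : E'} {a b : ℂ} (ha : a ∈ E) (hb : b ∈ E)
    (e : (z : ℂ) = a + b * s) : (h.fn z : ℂ) = a - b * s := by
  have h1 := (h.ex' z).choose_spec
  have := uniq h.notMem h1.1 h1.2.1 ha hb (h1.2.2.symm.trans e)
  rw [fn]; simp only
  rw [this.1, this.2]

theorem fn_fn (h : Step E E' s) (z : E') : h.fn (h.fn z) = z := by
  obtain ⟨⟨a, b⟩, ha, hb, e⟩ := h.ex' z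
  have h1 := h.fn_eq ha hb e
  apply Subtype.ext
  rw [h.fn_eq ha (neg_mem hb) (by rw [h1]; ring), e]; ring

/-- conjugation -/
noncomputable def conj (h : Step E E' s) : E' ≃+* E' where
  toFun := h.fn
  invFun := h.fn
  left_inv := h.fn_fn
  right_inv := h.fn_fn
  map_add' x y := by
    obtain ⟨⟨a, b⟩, ha, hb, e⟩ := h.ex' x
    obtain ⟨⟨a', b'⟩, ha', hb', e'⟩ := h.ex' y
    apply Subtype.ext
    simp only at ha hb e ha' hb' e'
    rw [h.fn_eq (a := a + a') (b := b + b') (add_mem ha ha') (add_mem hb hb')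
      (by push_cast; rw [e, e']; ring)]
    push_cast
    rw [h.fn_eq ha hb e, h.fn_eq ha' hb' e']; ring
  map_mul' x y := by
    obtain ⟨⟨a, b⟩, ha, hb, e⟩ := h.ex' x
    obtain ⟨⟨a', b'⟩, ha', hb', e'⟩ := h.ex' y
    apply Subtype.ext
    simp only at ha hb e ha' hb' e'
    rw [h.fn_eq (a := a * a' + b * b' * s ^ 2) (b := a * b' + a' * b)
      (add_mem (mul_mem ha ha') (mul_mem (mul_mem hb hb') h.sq))
      (add_mem (mul_mem ha hb') (mul_mem ha' hb)) (by push_cast; rw [e, e']; ring)]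
    push_cast
    rw [h.fn_eq ha hb e, h.fn_eq ha' hb' e']; ring

/-- conjugation on integers -/
noncomputable def σ (h : Step E E' s) : 𝓞 E' ≃+* 𝓞 E' := RingOfIntegers.mapRingEquiv h.conj

theorem v_σ (h : Step E E' s) {x : 𝓞 E'} {a b : ℂ} (ha : a ∈ E) (hb : b ∈ E)
    (e : v x = a + b * s) : v (h.σ x) = a - b * s :=
  h.fn_eq (z := (x : E')) ha hb e

theorem σ_incl (h : Step E E' s) (x : 𝓞 E) : h.σ (incl h.le x) = incl h.le x := by
  apply v_inj
  rw [h.v_σ (a := v x) (b := 0) (v_mem x) E.zero_mem (by simp)]; simp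

theorem σ_s (h : Step E E' s) {x : 𝓞 E'} (hx : v x = s) : h.σ x = - x := by
  apply v_inj
  rw [h.v_σ (a := 0) (b := 1) E.zero_mem E.one_mem (by rw [hx]; ring), map_neg, hx]; ring

/-- linear coordinates -/
theorem finrank_eq (h : Step E E' s) :
    letI : Algebra E E' := (IntermediateField.inclusion h.le).toRingHom.toAlgebra
    Module.finrank E E' = 2 := by
  letI : Algebra E E' := (IntermediateField.inclusion h.le).toRingHom.toAlgebra
  have hsm : ∀ (a : E) (x : E'), ((a • x : E') : ℂ) = a * x := fun a x => rfl
  let f : (E × E) →ₗ[E] E' :=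
    { toFun := fun p => ⟨p.1 + p.2 * s, add_mem (h.le p.1.2) (mul_mem (h.le p.2.2) h.mem)⟩
      map_add' := by intro x y; apply Subtype.ext; push_cast; simp; ring
      map_smul' := by intro r x; apply Subtype.ext; simp [hsm]; ring }
  have hf : Function.Bijective f := by
    constructor
    · rintro ⟨a, b⟩ ⟨a', b'⟩ e
      have := uniq h.notMem a.2 b.2 a'.2 b'.2 (congrArg Subtype.val e)
      exact Prod.ext (Subtype.ext this.1) (Subtype.ext this.2)
    · intro z
      obtain ⟨⟨a, b⟩, ha, hb, e⟩ := h.ex' z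
      exact ⟨(⟨a, ha⟩, ⟨b, hb⟩), Subtype.ext e.symm⟩
  rw [← (LinearEquiv.ofBijective f hf).finrank_eq]
  simp

theorem finite (h : Step E E' s) [NumberField E] : NumberField E' := by
  letI : Algebra E E' := (IntermediateField.inclusion h.le).toRingHom.toAlgebra
  have hfin : Module.Finite E E' := Module.finite_of_finrank_eq_succ (n := 1) h.finrank_eq
  haveI : IsScalarTower ℚ E E' := IsScalarTower.of_algebraMap_eq fun x => by
    apply Subtype.ext; rfl
  haveI : FiniteDimensional ℚ E' := Module.Finite.trans E E'
  constructor

end Step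
end TwoCl

set_option linter.unusedSectionVars false
set_option linter.style.haveILetI false
set_option linter.unusedVariables false

open IntermediateField NumberField

namespace TwoCl
namespace Step
variable {E E' : IntermediateField ℚ ℂ} {s : ℂ}

theorem norm_eq (h : Step E E' s) [NumberField E] [NumberField E'] (I : Ideal (𝓞 E)) :
    Ideal.absNorm (I.map (incl h.le)) = Ideal.absNorm I ^ 2 := by
  letI : Algebra E E' := (IntermediateField.inclusion h.le).toRingHom.toAlgebra
  have h1 := Ideal.absNorm_algebraMap (𝓞 E) (𝓞 E') I
  rw [← IsFractionRing.finrank_eq (𝓞 E) E (𝓞 E') E', h.finrank_eq] at h1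
  exact h1

theorem qd (h : Step E E' s) [NumberField E] [NumberField E'] (hs : IsIntegral ℤ s) :
    QD (incl h.le) h.σ where
  inj := by
    intro x y e
    apply v_inj
    rw [← v_incl h.le x, e, v_incl]
  fix := h.σ_incl
  inv b := by
    apply RingOfIntegers.ext
    exact h.fn_fn _
  mem b hb := by
    obtain ⟨⟨x, y⟩, hx, hy, e⟩ := h.ex' (b : E')
    have h1 := h.v_σ hx hy e
    rw [hb] at h1
    have e' : v b = x + y * s := e
    have h2 : v b = x := by linear_combination (h1 + e') / 2
    obtain ⟨a, ha⟩ := exists_v (E := E) (z := x) hx (h2 ▸ v_int b)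
    exact ⟨a, v_inj (by rw [v_incl, ha, h2])⟩
  nontriv := by
    obtain ⟨c, hc⟩ := exists_v h.mem hs
    refine ⟨c, ?_, h.σ_s hc⟩
    rintro rfl
    apply h.notMem
    rw [← hc, map_zero]; exact E.zero_mem
  norm := h.norm_eq

end Step

theorem QD.absNorm_span {A B : Type*} [CommRing A] [CommRing B] [IsDedekindDomain A]
    [IsDedekindDomain B] [Module.Free ℤ A] [Module.Finite ℤ A] [Module.Free ℤ B]
    [Module.Finite ℤ B] {i : A →+* B} {s : B ≃+* B} (h : QD i s) {x : B} {a : A}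
    (hx : x * s x = i a) : Ideal.absNorm (Ideal.span {x}) = Ideal.absNorm (Ideal.span {a}) := by
  have h1 := h.norm (Ideal.span {a})
  rw [Ideal.map_span, Set.image_singleton, ← hx, ← Ideal.span_singleton_mul_span_singleton,
    map_mul] at h1
  have h2 := h.absNorm_map_s (Ideal.span {x})
  rw [Ideal.map_span, Set.image_singleton] at h2
  rw [h2, ← sq] at h1
  exact Nat.pow_left_injective (n := 2) (by norm_num) h1

/-- The tower generators. -/
noncomputable def rc (n : ℕ) : ℝ := 2 * Real.cos (2 * Real.pi / 2 ^ (n + 2))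

/-- The tower generators in `ℂ`. -/
noncomputable def cc (n : ℕ) : ℂ := (rc n : ℂ)

theorem rc_zero : rc 0 = 0 := by
  rw [rc]
  have : 2 * Real.pi / 2 ^ (0 + 2) = Real.pi / 2 := by ring
  rw [this, Real.cos_pi_div_two, mul_zero]

theorem rc_succ (n : ℕ) : rc (n + 1) ^ 2 = 2 + rc n := by
  have : 2 * Real.pi / 2 ^ (n + 2) = 2 * (2 * Real.pi / 2 ^ (n + 1 + 2)) := by
    rw [pow_succ 2 (n + 1 + 1)]; field_simp
  rw [rc, rc, this, Real.cos_two_mul]; ring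

theorem cc_zero : cc 0 = 0 := by rw [cc, rc_zero]; rfl

theorem cc_succ (n : ℕ) : cc (n + 1) ^ 2 = 2 + cc n := by
  rw [cc, cc]; exact_mod_cast rc_succ n

theorem cc_int (n : ℕ) : IsIntegral ℤ (cc n) := by
  induction n with
  | zero => rw [cc_zero]; exact isIntegral_zero
  | succ n ih =>
    apply IsIntegral.of_pow (n := 2) (by norm_num)
    rw [cc_succ]
    exact (isIntegral_algebraMap (R := ℤ) (x := 2)).add ih

/-- recursive construction of `F n` with its generator. -/
noncomputable def FS : (n : ℕ) → {E : IntermediateField ℚ ℂ // cc n ∈ E}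
  | 0 => ⟨⊥, by rw [cc_zero]; exact zero_mem _⟩
  | (n + 1) => ⟨adj (FS n).1 (cc (n + 1)) (by
      rw [cc_succ]; exact add_mem ((FS n).1.natCast_mem 2) (FS n).2), s_mem_adj⟩

/-- `F n = ℚ(c_n)`. -/
noncomputable def F (n : ℕ) : IntermediateField ℚ ℂ := (FS n).1

theorem cc_mem (n : ℕ) : cc n ∈ F n := (FS n).2

theorem sq_mem (n : ℕ) : cc (n + 1) ^ 2 ∈ F n := by
  rw [cc_succ]; exact add_mem ((F n).natCast_mem 2) (cc_mem n)

theorem F_succ (n : ℕ) : F (n + 1) = adj (F n) (cc (n + 1)) (sq_mem n) := rfl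

theorem F_zero : F 0 = ⊥ := rfl

theorem F_real (n : ℕ) : ∀ z ∈ F n, z.im = 0 := by
  induction n with
  | zero =>
    intro z hz
    rw [F_zero, IntermediateField.mem_bot] at hz
    obtain ⟨r, rfl⟩ := hz
    simp
  | succ n ih =>
    rintro z ⟨a, ha, b, hb, rfl⟩
    simp [ih a ha, ih b hb, cc]

theorem not_sq (n : ℕ) : ∀ y ∈ F n, y ^ 2 ≠ 2 + cc n ∧ y ^ 2 ≠ 2 - cc n := by
  induction n with
  | zero =>
    intro z hz
    rw [F_zero, IntermediateField.mem_bot] at hz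
    obtain ⟨r, rfl⟩ := hz
    have : (algebraMap ℚ ℂ r) ^ 2 ≠ 2 := by
      intro h
      have h2 : r ^ 2 = 2 := by
        have : ((r ^ 2 : ℚ) : ℂ) = (2 : ℚ) := by push_cast; exact h
        exact_mod_cast this
      have : IsSquare (2 : ℚ) := ⟨r, by rw [← h2]; ring⟩
      rw [show (2 : ℚ) = ((2 : ℕ) : ℚ) by norm_num, Rat.isSquare_natCast_iff] at this
      exact Nat.prime_two.prime.not_isSquare this
    rw [cc_zero]; simpa using this
  | succ n ih =>
    rintro y ⟨a, ha, b, hb, rfl⟩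
    have hn : cc (n + 1) ∉ F n := fun h => (ih _ h).1 (cc_succ n)
    have key : ∀ e : ℂ, e ^ 2 = 1 → e ∈ F n → (a + b * cc (n + 1)) ^ 2 ≠ 2 + e * cc (n + 1) := by
      intro e he heF h
      have hm : a ^ 2 + b ^ 2 * cc (n + 1) ^ 2 ∈ F n :=
        add_mem (pow_mem ha 2) (mul_mem (pow_mem hb 2) (sq_mem n))
      obtain ⟨h1, h2⟩ := uniq hn hm (mul_mem (mul_mem ((F n).natCast_mem 2) ha) hb)
        ((F n).natCast_mem 2) heF (by push_cast; linear_combination h)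
      apply (ih (a ^ 2 - b ^ 2 * cc (n + 1) ^ 2)
        (sub_mem (pow_mem ha 2) (mul_mem (pow_mem hb 2) (sq_mem n)))).2
      push_cast at h1 h2
      have h3 := cc_succ n
      linear_combination (a ^ 2 + b ^ 2 * cc (n + 1) ^ 2 + 2) * h1 -
        cc (n + 1) ^ 2 * (2 * a * b + e) * h2 - cc (n + 1) ^ 2 * he - h3
    refine ⟨?_, ?_⟩
    · have := key 1 (by ring) (F n).one_mem
      rwa [one_mul] at this
    · have := key (-1) (by ring) (neg_mem (F n).one_mem)
      rwa [neg_one_mul, ← sub_eq_add_neg] at this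

theorem cc_notMem (n : ℕ) : cc (n + 1) ∉ F n := fun h => (not_sq n _ h).1 (cc_succ n)

theorem stepF (n : ℕ) : Step (F n) (F (n + 1)) (cc (n + 1)) :=
  step_adj (hs := sq_mem n) (cc_notMem n)

instance nfF (n : ℕ) : NumberField (F n) := by
  induction n with
  | zero =>
    rw [F_zero]
    haveI : FiniteDimensional ℚ (⊥ : IntermediateField ℚ ℂ) := inferInstance
    constructor
  | succ n ih => exact (stepF n).finite

/-- `c_n` as an integer. -/
noncomputable def c (n : ℕ) : 𝓞 (F n) := (exists_v (cc_mem n) (cc_int n)).choose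

@[simp] theorem v_c (n : ℕ) : v (c n) = cc n := (exists_v (cc_mem n) (cc_int n)).choose_spec

/-- abbreviation for the inclusion -/
noncomputable abbrev iF (n : ℕ) : 𝓞 (F n) →+* 𝓞 (F (n + 1)) := incl (stepF n).le

/-- abbreviation for the conjugation -/
noncomputable abbrev sF (n : ℕ) : 𝓞 (F (n + 1)) ≃+* 𝓞 (F (n + 1)) := (stepF n).σ

theorem qdF (n : ℕ) : QD (iF n) (sF n) := (stepF n).qd (cc_int _)

theorem c_sq (n : ℕ) : c (n + 1) ^ 2 = 2 + iF n (c n) := by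
  apply v_inj; rw [map_pow, map_add, v_incl, v_c, v_c, map_ofNat, cc_succ]

theorem sF_c (n : ℕ) : sF n (c (n + 1)) = - c (n + 1) := (stepF n).σ_s (v_c _)

theorem c_zero : c 0 = 0 := v_inj (by simp [cc_zero])

theorem absNorm_two_pm (n : ℕ) : Ideal.absNorm (Ideal.span {2 + c n}) = 2 ∧
    Ideal.absNorm (Ideal.span {2 - c n}) = 2 := by
  induction n with
  | zero =>
    have : Ideal.absNorm (Ideal.span {(2 : 𝓞 (F 0))}) = 2 := by
      have h := Ideal.absNorm_span_natCast (S := 𝓞 (F 0)) 2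
      rw [RingOfIntegers.rank] at h
      have h1 : Module.finrank ℚ (F 0) = 1 := by rw [F_zero]; exact IntermediateField.finrank_bot
      rw [h1] at h
      simpa using h
    rw [c_zero, add_zero, sub_zero]; exact ⟨this, this⟩
  | succ n ih =>
    have h1 : (2 + c (n + 1)) * sF n (2 + c (n + 1)) = iF n (2 - c n) := by
      rw [map_add, sF_c, map_ofNat, map_sub, map_ofNat]; linear_combination -(c_sq n)
    have h2 : (2 - c (n + 1)) * sF n (2 - c (n + 1)) = iF n (2 - c n) := by
      rw [map_sub, sF_c, map_ofNat, map_sub, map_ofNat]; linear_combination -(c_sq n)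
    rw [(qdF n).absNorm_span h1, (qdF n).absNorm_span h2]
    exact ⟨ih.2, ih.2⟩

theorem absNorm_c (n : ℕ) : Ideal.absNorm (Ideal.span {c (n + 1)}) = 2 := by
  have h1 : c (n + 1) * sF n (c (n + 1)) = iF n (- (2 + c n)) := by
    rw [sF_c, map_neg, map_add, map_ofNat]; linear_combination -(c_sq n)
  rw [(qdF n).absNorm_span h1, Ideal.span_singleton_neg]
  exact (absNorm_two_pm n).1

theorem prime_of_absNorm {R : Type*} [CommRing R] [IsDedekindDomain R] [Module.Free ℤ R]
    [Module.Finite ℤ R] {x : R} (h : Ideal.absNorm (Ideal.span {x}) = 2) : Prime x := by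
  have h0 : x ≠ 0 := by
    rintro rfl
    rw [Ideal.span_singleton_zero, Ideal.absNorm_bot] at h
    norm_num at h
  rw [← Ideal.span_singleton_prime h0]
  exact Ideal.isPrime_of_irreducible_absNorm (by rw [h]; exact Nat.prime_two)

theorem prime_c (n : ℕ) : Prime (c (n + 1)) := prime_of_absNorm (absNorm_c n)

theorem prime_two_add (n : ℕ) : Prime (2 + c n) := prime_of_absNorm (absNorm_two_pm n).1

theorem c_dvd_two (n : ℕ) : c (n + 1) ∣ 2 := by
  rw [← Ideal.mem_span_singleton]
  have := Ideal.absNorm_mem (Ideal.span {c (n + 1)})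
  rw [absNorm_c] at this
  exact_mod_cast this

/-- every prime containing 2 contains all generators -/
theorem c_mem_of_two_mem (n : ℕ) {R : Type*} [CommRing R] (f : 𝓞 (F n) →+* R) {P : Ideal R}
    (hP : P.IsPrime) (h2 : (2 : R) ∈ P) : f (c n) ∈ P := by
  induction n with
  | zero => rw [c_zero, map_zero]; exact zero_mem _
  | succ n ih =>
    apply hP.mem_of_pow_mem 2
    rw [← map_pow, c_sq, map_add, map_ofNat]
    exact add_mem h2 (ih (f.comp (iF n)))

end TwoCl

set_option linter.unusedSectionVars false
set_option linter.style.haveILetI false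
set_option linter.unusedVariables false

open IntermediateField NumberField

namespace TwoCl

/-- `X n k = 2 cos (k θ_n)` -/
noncomputable def X (n k : ℕ) : 𝓞 (F n) := (Polynomial.dickson 1 (1 : 𝓞 (F n)) k).eval (c n)

theorem X_zero (n : ℕ) : X n 0 = 2 := by
  rw [X, Polynomial.dickson_zero]; norm_num

theorem X_one (n : ℕ) : X n 1 = c n := by
  rw [X, Polynomial.dickson_one]; simp

theorem X_add_two (n k : ℕ) : X n (k + 2) = c n * X n (k + 1) - X n k := by
  rw [X, Polynomial.dickson_add_two]; simp [X]

/-- the angle -/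
noncomputable def θ (n : ℕ) : ℝ := 2 * Real.pi / 2 ^ (n + 2)

theorem θ_succ (n : ℕ) : θ n = 2 * θ (n + 1) := by
  rw [θ, θ, pow_succ 2 (n + 1 + 1)]; field_simp

theorem θ_pi (n : ℕ) : 2 ^ (n + 1) * θ n = Real.pi := by
  rw [θ, pow_succ 2 (n + 1)]; field_simp

theorem v_X (n k : ℕ) : v (X n k) = ((2 * Real.cos (k * θ n) : ℝ) : ℂ) := by
  induction k using Nat.twoStepInduction with
  | zero => rw [X_zero, map_ofNat]; simp
  | one => rw [X_one, v_c, cc, rc, θ]; simp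
  | more k h0 h1 =>
    have hc : rc n = 2 * Real.cos (θ n) := rfl
    rw [X_add_two, map_sub, map_mul, h0, h1, v_c, cc, hc]
    norm_cast
    have e1 : ((k + 2 : ℕ) : ℝ) * θ n = (k + 1 : ℕ) * θ n + θ n := by push_cast; ring
    have e2 : ((k : ℕ) : ℝ) * θ n = (k + 1 : ℕ) * θ n - θ n := by push_cast; ring
    rw [e1, e2, Real.cos_add, Real.cos_sub]
    ring

theorem sF_X (n k : ℕ) : sF n (X (n + 1) k) = (-1) ^ k * X (n + 1) k := by
  induction k using Nat.twoStepInduction with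
  | zero => rw [X_zero, map_ofNat]; simp
  | one => rw [X_one, sF_c]; simp
  | more k h0 h1 =>
    rw [X_add_two, map_sub, map_mul, h0, h1, sF_c]; ring

theorem X_double (n k : ℕ) : X (n + 1) k ^ 2 = 2 + iF n (X n k) := by
  apply v_inj
  rw [map_pow, map_add, v_incl, map_ofNat, v_X, v_X, θ_succ n]
  norm_cast
  rw [show (k : ℝ) * (2 * θ (n + 1)) = 2 * (k * θ (n + 1)) by ring, Real.cos_two_mul]
  ring

theorem X_shift (n k : ℕ) : X n (k + 2 ^ (n + 1)) = - X n k := by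
  apply v_inj
  rw [map_neg, v_X, v_X]
  norm_cast
  push_cast
  rw [add_mul, θ_pi, Real.cos_add_pi]; ring

theorem pow_form (l : ℕ) (hl : l % 8 = 3 ∨ l % 8 = 5) (n : ℕ) :
    ∃ t e : ℤ, (e = 1 ∨ e = -1) ∧ ((l ^ 2 ^ n : ℕ) : ℤ) = (2 * t + 1) * 2 ^ (n + 2) + e := by
  induction n with
  | zero =>
    rcases hl with hl | hl
    · exact ⟨l / 8, -1, Or.inr rfl, by push_cast; norm_num; omega⟩
    · exact ⟨l / 8, 1, Or.inl rfl, by push_cast; norm_num; omega⟩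
  | succ n ih =>
    obtain ⟨t, e, he, h⟩ := ih
    rw [pow_succ 2 n, pow_mul]
    push_cast at h ⊢
    rw [h]
    rcases he with rfl | rfl
    · exact ⟨t + (2 * t + 1) ^ 2 * 2 ^ n, 1, Or.inl rfl, by ring⟩
    · exact ⟨-t - 1 + (2 * t + 1) ^ 2 * 2 ^ n, 1, Or.inl rfl, by ring⟩

theorem X_frob (l : ℕ) (hl : l % 8 = 3 ∨ l % 8 = 5) (n : ℕ) :
    X (n + 1) (l ^ 2 ^ n) = - c (n + 1) := by
  obtain ⟨t, e, he, h⟩ := pow_form l hl n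
  rw [← X_one]
  apply v_inj
  rw [map_neg, v_X, v_X]
  have h' : ((l ^ 2 ^ n : ℕ) : ℝ) = (2 * t + 1) * 2 ^ (n + 2) + e := by exact_mod_cast h
  have h2 : ((l ^ 2 ^ n : ℕ) : ℝ) * θ (n + 1) = e * θ (n + 1) + Real.pi + t * (2 * Real.pi) := by
    rw [h', add_mul, mul_assoc, θ_pi]; ring
  rw [h2, Real.cos_add_int_mul_two_pi, Real.cos_add_pi]
  rcases he with rfl | rfl <;> push_cast <;> simp

theorem dickson_pow {R : Type*} [CommRing R] (l : ℕ) [Fact l.Prime] [CharP R l] (m : ℕ) :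
    Polynomial.dickson 1 (1 : R) (l ^ m) = Polynomial.X ^ (l ^ m) := by
  induction m with
  | zero => simp
  | succ m ih =>
    rw [pow_succ, Polynomial.dickson_one_one_mul, ih, Polynomial.dickson_one_one_charP R l]
    simp [pow_mul, mul_comm]

theorem absNorm_l (l n : ℕ) : Ideal.absNorm (Ideal.span {(l : 𝓞 (F n))}) = l ^ 2 ^ n := by
  induction n with
  | zero =>
    have h := Ideal.absNorm_span_natCast (S := 𝓞 (F 0)) l
    rw [RingOfIntegers.rank] at h
    have h1 : Module.finrank ℚ (F 0) = 1 := by rw [F_zero]; exact IntermediateField.finrank_bot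
    rw [h1] at h
    simpa using h
  | succ n ih =>
    have := (qdF n).norm (Ideal.span {(l : 𝓞 (F n))})
    rw [Ideal.map_span, Set.image_singleton, map_natCast, ih] at this
    rw [this, ← pow_mul, pow_succ]

theorem two_notMem {R : Type*} [CommRing R] {P : Ideal R} (hP : P ≠ ⊤) {l : ℕ} (hl : l % 2 = 1)
    (h : (l : R) ∈ P) (h2 : (2 : R) ∈ P) : False := by
  apply hP
  rw [Ideal.eq_top_iff_one]
  have e : (l : R) = 2 * (l / 2 : ℕ) + 1 := by
    conv_lhs => rw [← Nat.div_add_mod l 2, hl]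
    push_cast; ring
  have : (1 : R) = l - 2 * (l / 2 : ℕ) := by rw [e]; ring
  rw [this]
  exact sub_mem h (P.mul_mem_right _ h2)

theorem inert (l : ℕ) (hlp : l.Prime) (hl : l % 8 = 3 ∨ l % 8 = 5) (n : ℕ) :
    Prime (l : 𝓞 (F n)) := by
  have hne : ∀ n, (l : 𝓞 (F n)) ≠ 0 := fun n => Nat.cast_ne_zero.2 hlp.ne_zero
  induction n with
  | zero =>
    rw [← Ideal.span_singleton_prime (hne 0)]
    apply Ideal.isPrime_of_irreducible_absNorm
    rw [absNorm_l, pow_zero, pow_one]; exact hlp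
  | succ n ih =>
    have hp := (Ideal.span_singleton_prime (hne n)).2 ih
    have hpm : (Ideal.span {(l : 𝓞 (F n))}).IsMaximal := hp.isMaximal (by simpa using hne n)
    have hnt : Ideal.span {(l : 𝓞 (F (n + 1)))} ≠ ⊤ := by
      intro h
      have := absNorm_l l (n + 1)
      rw [h, Ideal.absNorm_top] at this
      have h1 := Nat.one_lt_pow (n := 2 ^ (n + 1)) (by positivity) hlp.one_lt
      omega
    obtain ⟨P, hPm, hle⟩ := Ideal.exists_le_maximal _ hnt
    have hlP : (l : 𝓞 (F (n + 1))) ∈ P := hle (Ideal.mem_span_singleton_self _)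
    have hP0 : P ≠ ⊥ := by
      rintro rfl
      exact hne (n + 1) (Ideal.mem_bot.1 hlP)
    have hcomap : P.comap (iF n) = Ideal.span {(l : 𝓞 (F n))} := by
      refine (hpm.eq_of_le (Ideal.comap_ne_top _ hPm.ne_top) ?_).symm
      rw [Ideal.span_singleton_le_iff_mem, Ideal.mem_comap, map_natCast]; exact hlP
    have h2c : 2 * c (n + 1) ∉ P := by
      intro h
      have h2 : (2 : 𝓞 (F (n + 1))) ∈ P := by
        rcases hPm.isPrime.mem_or_mem h with h | h
        · exact h
        · exact Ideal.mem_of_dvd _ (c_dvd_two n) h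
      exact two_notMem hPm.ne_top (by omega) hlP h2
    have hspan : (Ideal.span {(l : 𝓞 (F n))}).map (iF n) = Ideal.span {(l : 𝓞 (F (n + 1)))} := by
      rw [Ideal.map_span, Set.image_singleton, map_natCast]
    rcases (qdF n).trichotomy hPm.isPrime hP0 with h1 | h1 | h1
    · exfalso
      apply h2c
      have hn : P.absNorm = l ^ 2 ^ n := by
        have h3 := congrArg Ideal.absNorm h1.2
        rw [map_mul, (qdF n).absNorm_map_s, (qdF n).norm, hcomap, absNorm_l, ← sq] at h3
        exact Nat.pow_left_injective (n := 2) (by norm_num) h3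
      letI : Field (𝓞 (F (n + 1)) ⧸ P) := Ideal.Quotient.field P
      haveI : Finite (𝓞 (F (n + 1)) ⧸ P) := by
        rw [← Ideal.absNorm_ne_zero_iff, Ne, Ideal.absNorm_eq_zero_iff]; exact hP0
      letI := Fintype.ofFinite (𝓞 (F (n + 1)) ⧸ P)
      haveI : Fact l.Prime := ⟨hlp⟩
      haveI : CharP (𝓞 (F (n + 1)) ⧸ P) l := by
        apply (CharP.charP_iff_prime_eq_zero hlp).2
        rw [← map_natCast (Ideal.Quotient.mk P), Ideal.Quotient.eq_zero_iff_mem]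
        exact hlP
      have hcard : Fintype.card (𝓞 (F (n + 1)) ⧸ P) = l ^ 2 ^ n := by
        rw [← hn, Ideal.absNorm_apply, Submodule.cardQuot_apply, Nat.card_eq_fintype_card]
      have h4 := FiniteField.pow_card (Ideal.Quotient.mk P (c (n + 1)))
      rw [hcard] at h4
      have h5 : Ideal.Quotient.mk P (X (n + 1) (l ^ 2 ^ n)) =
          Ideal.Quotient.mk P (c (n + 1)) ^ (l ^ 2 ^ n) := by
        rw [X, ← Polynomial.eval_map_apply, Polynomial.map_dickson, map_one, dickson_pow l]
        simp
      rw [h4, X_frob l hl, Ideal.Quotient.eq] at h5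
      have := neg_mem h5
      convert this using 1; ring
    · have hP := h1.2
      rw [hcomap, hspan] at hP
      rw [← Ideal.span_singleton_prime (hne _), ← hP]
      exact hPm.isPrime
    · exfalso
      apply h2c
      have := neg_mem (h1.2.2.2.2 (c (n + 1)))
      rw [sF_c] at this
      convert this using 1; ring

end TwoCl

set_option linter.unusedSectionVars false
set_option linter.style.haveILetI false
set_option linter.unusedVariables false

open IntermediateField NumberField

namespace TwoCl

theorem odd_card_of {G : Type*} [Group G] [Finite G] (h : ∀ x : G, x ^ 2 = 1 → x = 1) :
    Odd (Nat.card G) := by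
  by_contra hc
  rw [Nat.not_odd_iff_even, even_iff_two_dvd] at hc
  haveI : Fact (Nat.Prime 2) := ⟨Nat.prime_two⟩
  obtain ⟨x, hx⟩ := exists_prime_orderOf_dvd_card' 2 hc
  have := h x (by rw [← hx]; exact pow_orderOf_eq_one x)
  rw [this, orderOf_one] at hx
  omega

theorem eq_one_of_odd {G : Type*} [Group G] {x : G} {m : ℕ} (ho : Odd m) (h1 : x ^ 2 = 1)
    (h2 : x ^ m = 1) : x = 1 := by
  obtain ⟨k, rfl⟩ := ho
  rwa [pow_add, pow_mul, h1, one_pow, one_mul, pow_one] at h2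

section Q
variable {A B : Type*} [CommRing A] [CommRing B] [IsDedekindDomain A] [IsDedekindDomain B]
  [Module.Free ℤ A] [Module.Finite ℤ A] [Module.Free ℤ B] [Module.Finite ℤ B]
variable {i : A →+* B} {s : B ≃+* B}

namespace QD

theorem s_inv_unit (h : QD i s) (u : Bˣ) : s ((u⁻¹ : Bˣ) : B) * s (u : B) = 1 := by
  rw [← map_mul, Units.inv_mul, map_one]

theorem unit_mem (h : QD i s) (ε : Bˣ) (hsε : s (ε : B) = ε) : ∃ e : Aˣ, i e = (ε : B) := by
  have hsε' : s ((ε⁻¹ : Bˣ) : B) = (ε⁻¹ : Bˣ) := by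
    have h1 : s ((ε : B) * ((ε⁻¹ : Bˣ) : B)) = 1 := by rw [Units.mul_inv, map_one]
    rw [map_mul, hsε] at h1
    exact (Units.inv_eq_of_mul_eq_one_right h1).symm
  obtain ⟨u, hu⟩ := h.mem _ hsε
  obtain ⟨v, hv⟩ := h.mem _ hsε'
  have huv : u * v = 1 := h.inj (by rw [map_mul, hu, hv, Units.mul_inv, map_one])
  exact ⟨Units.mkOfMulEqOne u v huv, hu⟩

theorem norm_unit (h : QD i s) (ε : Bˣ) : ∃ e : Aˣ, i e = (ε : B) * s ε := by
  obtain ⟨e, he⟩ := h.unit_mem (ε * Units.map (s : B →* B) ε) (by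
    push_cast
    simp only [Units.coe_map, MonoidHom.coe_coe, map_mul, h.inv]
    rw [mul_comm])
  exact ⟨e, by rw [he]; simp⟩

theorem descend (h : QD i s) {J : Ideal A} (hJ : J ≠ ⊥) {β : B}
    (e : J.map i = Ideal.span {β}) : ∃ a : A, J ^ 2 = Ideal.span {a} := by
  obtain ⟨a, ha⟩ := h.mem (β * s β) (by rw [map_mul, h.inv, mul_comm])
  refine ⟨a, h.map_i_injective (pow_ne_zero 2 hJ) ?_⟩
  have e2 : Ideal.span {β} = Ideal.span {s β} := by
    have := h.map_i_s J
    rw [e, Ideal.map_span, Set.image_singleton] at this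
    exact this.symm
  rw [Ideal.map_pow, e, Ideal.map_span, Set.image_singleton, ha, sq,
    ← Ideal.span_singleton_mul_span_singleton]
  congr 1

theorem descend_odd (h : QD i s) (hodd : Odd (Nat.card (ClassGroup A))) {J : Ideal A} (hJ : J ≠ ⊥)
    {β : B} (e : J.map i = Ideal.span {β}) : ∃ b : A, b ≠ 0 ∧ J = Ideal.span {b} := by
  obtain ⟨a, ha⟩ := h.descend hJ e
  rw [← cl_eq_one_iff hJ]
  have ha0 : a ≠ 0 := by
    rintro rfl
    apply pow_ne_zero 2 hJ
    rw [ha]; simp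
  refine eq_one_of_odd hodd ?_ (pow_card_eq_one' (x := cl J hJ))
  rw [sq, ← cl_mul, cl_eq_one_iff]
  exact ⟨a, ha0, by rw [← ha, sq]⟩

theorem amb_form (h : QD i s) {c : B} (hram : ∀ P, h.Ram P → P = Ideal.span {c})
    {I : Ideal B} (hI : I ≠ ⊥) (hs : I.map s = I) :
    ∃ (J : Ideal A) (a : ℕ), J ≠ ⊥ ∧ I = Ideal.span {c} ^ a * J.map i := by
  have H := h.ambiguous hI hs
  clear hI hs
  induction H using Submonoid.closure_induction with
  | mem x hx =>
    rcases hx with ⟨J, hJ, rfl⟩ | hx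
    · exact ⟨J, 0, hJ, by simp⟩
    · exact ⟨⊤, 1, top_ne_bot, by rw [Ideal.map_top, pow_one, Ideal.mul_top]; exact hram x hx⟩
  | one => exact ⟨⊤, 0, top_ne_bot, by rw [Ideal.map_top, pow_zero, Ideal.mul_top]⟩
  | mul x y _ _ hx hy =>
    obtain ⟨J, a, hJ, rfl⟩ := hx
    obtain ⟨J', a', hJ', rfl⟩ := hy
    exact ⟨J * J', a + a', mul_ne_zero hJ hJ', by rw [Ideal.map_mul]; ring⟩

theorem corU (h : QD i s) (hodd : Odd (Nat.card (ClassGroup A))) {c : B} (hc0 : c ≠ 0)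
    (hc : s c = - c) (hram : ∀ P, h.Ram P → P = Ideal.span {c}) (η : Bˣ)
    (hη : (η : B) * s η = 1) :
    ∃ (w : Bˣ) (e : Bˣ), (e = 1 ∨ e = -1) ∧ (η : B) * s w = e * w := by
  obtain ⟨β, hβ0, hβ⟩ := h.hilbert90 (a := (η : B)) (b := 1) η.ne_zero one_ne_zero
    (by rw [hη, map_one, one_mul])
  rw [mul_one] at hβ
  have hI : Ideal.span {β} ≠ ⊥ := by simpa using hβ0
  have hsI : (Ideal.span {β}).map s = Ideal.span {β} := by
    rw [Ideal.map_span, Set.image_singleton, Ideal.span_singleton_eq_span_singleton]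
    exact ⟨η, hβ⟩
  obtain ⟨J, a, hJ, e⟩ := h.amb_form hram hI hsI
  rw [Ideal.span_singleton_pow] at e
  have hdvd : c ^ a ∣ β := by
    rw [← Ideal.span_singleton_le_span_singleton, e]; exact Ideal.mul_le_left
  obtain ⟨β', rfl⟩ := hdvd
  have hca : c ^ a ≠ 0 := pow_ne_zero _ hc0
  rw [← Ideal.span_singleton_mul_span_singleton] at e
  have hcI : Ideal.span {c ^ a} ≠ ⊥ := by rwa [Ne, Ideal.span_singleton_eq_bot]
  have e' := mul_left_cancel₀ hcI e
  obtain ⟨b, hb0, hb⟩ := h.descend_odd hodd hJ e'.symm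
  rw [hb, Ideal.map_span, Set.image_singleton, eq_comm, Ideal.span_singleton_eq_span_singleton] at e'
  obtain ⟨w, hw⟩ := e'
  have hib : i b ≠ 0 := by rwa [Ne, map_eq_zero_iff i h.inj]
  rw [← hw] at hβ
  simp only [map_mul, map_pow, hc, h.fix] at hβ
  refine ⟨w, (-1) ^ a, neg_one_pow_eq_or _ a, ?_⟩
  apply mul_left_cancel₀ (mul_ne_zero hca hib)
  rw [neg_pow] at hβ
  have h1 : ((-1 : B) ^ a) * (-1) ^ a = 1 := by rw [← mul_pow]; simp
  push_cast
  linear_combination ((-1) ^ a) * hβ - (c ^ a * i b * s w * η) * h1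

theorem s_eq_of_sq (h : QD i s) (hodd : Odd (Nat.card (ClassGroup A))) {x : ClassGroup B}
    (hx : x ^ 2 = 1) : sCl s x = x := by
  obtain ⟨d, hd⟩ := h.cl_mul_s x
  have h1 : x * sCl s x = 1 := by
    refine eq_one_of_odd hodd ?_ ?_
    · rw [mul_pow, ← map_pow, hx, map_one, one_mul]
    · rw [hd, ← map_pow, pow_card_eq_one', map_one]
  have h2 : x * x = 1 := by rw [← sq, hx]
  exact mul_left_cancel (h1.trans h2.symm)

end QD
end Q

theorem ramF (n : ℕ) (P : Ideal (𝓞 (F (n + 1)))) (hP : (qdF n).Ram P) :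
    P = Ideal.span {c (n + 1)} := by
  have h1 := hP.2.2.2.2 (c (n + 1))
  rw [sF_c] at h1
  have h2 : 2 * c (n + 1) ∈ P := by
    have := neg_mem h1
    convert this using 1; ring
  have h3 : c (n + 1) ∈ P := by
    rcases hP.1.mem_or_mem h2 with h | h
    · exact c_mem_of_two_mem (n + 1) (RingHom.id _) hP.1 h
    · exact h
  have hp := (Ideal.span_singleton_prime (prime_c n).ne_zero).2 (prime_c n)
  have hm : (Ideal.span {c (n + 1)}).IsMaximal :=
    hp.isMaximal (by simpa using (prime_c n).ne_zero)
  exact (hm.eq_of_le hP.1.ne_top (by rwa [Ideal.span_singleton_le_iff_mem])).symm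

theorem corUF (n : ℕ) (hodd : Odd (Nat.card (ClassGroup (𝓞 (F n))))) (η : (𝓞 (F (n + 1)))ˣ)
    (hη : (η : 𝓞 (F (n + 1))) * sF n η = 1) :
    ∃ w e : (𝓞 (F (n + 1)))ˣ, (e = 1 ∨ e = -1) ∧ (η : 𝓞 (F (n + 1))) * sF n w = e * w :=
  (qdF n).corU hodd (prime_c n).ne_zero (sF_c n) (ramF n) η hη

/-- norm computation for cyclotomic units -/
theorem norm_e (n k : ℕ) (hk : Odd k) :
    (X (n + 1) k - 1) * sF n (X (n + 1) k - 1) = iF n (X n (k + 2 ^ (n + 1)) - 1) := by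
  rw [map_sub, sF_X, hk.neg_one_pow, map_one, X_shift, map_sub, map_neg, map_one]
  linear_combination -(X_double n k)

theorem odd_shift {n k : ℕ} (hk : Odd k) : Odd (k + 2 ^ (n + 1)) :=
  hk.add_even ((even_two).pow_of_ne_zero (by omega))

theorem X_zero_odd {k : ℕ} (hk : Odd k) : X 0 k = 0 := by
  obtain ⟨m, rfl⟩ := hk
  induction m with
  | zero => rw [mul_zero, zero_add, X_one, c_zero]
  | succ m ih =>
    have : 2 * (m + 1) + 1 = (2 * m + 1) + 2 ^ (0 + 1) := by ring
    rw [this, X_shift, ih, neg_zero]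

theorem isUnit_e (n k : ℕ) (hk : Odd k) : IsUnit (X n k - 1) := by
  induction n generalizing k with
  | zero => rw [X_zero_odd hk]; simp
  | succ n ih =>
    have h := (ih _ (odd_shift (n := n) hk)).map (iF n)
    rw [← norm_e n k hk] at h
    exact isUnit_of_mul_isUnit_left h

/-- cyclotomic units -/
noncomputable def U (n : ℕ) : Subgroup (𝓞 (F n))ˣ :=
  Subgroup.closure {u | ∃ k, Odd k ∧ (u : 𝓞 (F n)) = X n k - 1}

/-- unit maps -/
noncomputable abbrev iU (n : ℕ) : (𝓞 (F n))ˣ →* (𝓞 (F (n + 1)))ˣ := Units.map (iF n : _ →* _)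

/-- unit maps -/
noncomputable abbrev sU (n : ℕ) : (𝓞 (F (n + 1)))ˣ →* (𝓞 (F (n + 1)))ˣ :=
  Units.map (sF n : _ →* _)

theorem U_norm (n : ℕ) : ∀ u ∈ U n, ∃ w ∈ U (n + 1), w * sU n w = iU n u := by
  intro u hu
  induction hu using Subgroup.closure_induction with
  | mem u hu =>
    obtain ⟨k, hk, e⟩ := hu
    obtain ⟨w, hw⟩ := isUnit_e (n + 1) (k + 2 ^ (n + 1)) (odd_shift hk)
    refine ⟨w, Subgroup.subset_closure ⟨_, odd_shift hk, hw⟩, ?_⟩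
    apply Units.ext
    have h1 := norm_e n (k + 2 ^ (n + 1)) (odd_shift hk)
    rw [X_shift n (k + 2 ^ (n + 1)), X_shift n k, neg_neg, ← e, ← hw] at h1
    simpa using h1
  | one => exact ⟨1, one_mem _, by simp⟩
  | mul a b _ _ ha hb =>
    obtain ⟨w, hw, e⟩ := ha
    obtain ⟨w', hw', e'⟩ := hb
    exact ⟨w * w', mul_mem hw hw', by
      rw [map_mul, map_mul, ← e, ← e', mul_mul_mul_comm]⟩
  | inv a _ ha =>
    obtain ⟨w, hw, e⟩ := ha
    exact ⟨w⁻¹, inv_mem hw, by rw [map_inv, map_inv, ← e, mul_inv]⟩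

theorem U_sigma (n : ℕ) : ∀ u ∈ U (n + 1), sU n u ∈ U (n + 1) := by
  intro u hu
  induction hu using Subgroup.closure_induction with
  | mem u hu =>
    obtain ⟨k, hk, e⟩ := hu
    refine Subgroup.subset_closure ⟨_, odd_shift (n := n + 1) hk, ?_⟩
    have : ((sU n u : (𝓞 (F (n + 1)))ˣ) : 𝓞 (F (n + 1))) = sF n u := rfl
    rw [this, e, map_sub, sF_X, hk.neg_one_pow, map_one, X_shift]; ring
  | one => rw [map_one]; exact one_mem _
  | mul a b _ _ ha hb => rw [map_mul]; exact mul_mem ha hb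
  | inv a _ ha => rw [map_inv]; exact inv_mem ha

theorem U_incl (n : ℕ) (u) (hu : u ∈ U n) : iU n u ∈ U (n + 1) := by
  obtain ⟨w, hw, e⟩ := U_norm n u hu
  rw [← e]; exact mul_mem hw (U_sigma n w hw)

theorem neg_one_mem_U (n : ℕ) : -1 ∈ U n := by
  induction n with
  | zero =>
    refine Subgroup.subset_closure ⟨1, odd_one, ?_⟩
    rw [X_one, c_zero]; simp
  | succ n ih =>
    have := U_incl n _ ih
    have e : iU n (-1) = -1 := by ext; simp
    rwa [e] at this

/-- totally positive -/
def TP {E : IntermediateField ℚ ℂ} (x : 𝓞 E) : Prop :=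
  ∀ φ : E →+* ℂ, ∃ r : ℝ, 0 < r ∧ φ (x : E) = r

theorem exists_ext {E E' : IntermediateField ℚ ℂ} {s : ℂ} (h : Step E E' s) [NumberField E]
    [NumberField E'] (φ : E →+* ℂ) :
    ∃ ψ : E' →+* ℂ, ∀ x : E, ψ (IntermediateField.inclusion h.le x) = φ x := by
  letI : Algebra E E' := (IntermediateField.inclusion h.le).toRingHom.toAlgebra
  haveI : Module.Finite E E' := Module.finite_of_finrank_eq_succ (n := 1) h.finrank_eq
  refine ⟨NumberField.ComplexEmbedding.lift E' φ, fun x => ?_⟩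
  exact NumberField.ComplexEmbedding.lift_algebraMap_apply E' φ x

theorem sq_real {z : ℂ} (t : ℝ) (ht : 0 ≤ t) (h : z ^ 2 = t) : ∃ r : ℝ, z = r ∧ r ^ 2 = t := by
  have h1 : (z - Real.sqrt t) * (z + Real.sqrt t) = 0 := by
    have : ((Real.sqrt t : ℝ) : ℂ) ^ 2 = t := by exact_mod_cast Real.sq_sqrt ht
    linear_combination h - this
  rcases mul_eq_zero.1 h1 with h2 | h2
  · exact ⟨Real.sqrt t, by linear_combination h2, Real.sq_sqrt ht⟩
  · exact ⟨-Real.sqrt t, by push_cast; linear_combination h2, by rw [neg_sq, Real.sq_sqrt ht]⟩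

theorem emb_c (n : ℕ) (φ : F n →+* ℂ) : ∃ r : ℝ, φ (c n : F n) = r ∧ |r| ≤ 2 := by
  induction n with
  | zero => exact ⟨0, by rw [c_zero]; simp, by simp⟩
  | succ n ih =>
    obtain ⟨r, hr, hr2⟩ := ih (φ.comp (IntermediateField.inclusion (stepF n).le).toRingHom)
    rw [abs_le] at hr2
    have h1 : φ (c (n + 1) : F (n + 1)) ^ 2 = ((2 + r : ℝ) : ℂ) := by
      have := congrArg (fun x : 𝓞 (F (n + 1)) => φ (x : F (n + 1))) (c_sq n)
      simp only [map_pow, map_add, map_ofNat] at this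
      rw [this]; push_cast; rw [← hr]; rfl
    obtain ⟨t, ht, ht2⟩ := sq_real _ (by linarith) h1
    exact ⟨t, ht, abs_le_of_sq_le_sq (by linarith) (by norm_num)⟩

theorem emb_real (n : ℕ) (φ : F n →+* ℂ) (x : F n) : ∃ r : ℝ, φ x = r := by
  induction n with
  | zero =>
    obtain ⟨q, hq⟩ := IntermediateField.mem_bot.1 (show (x : ℂ) ∈ (⊥ : IntermediateField ℚ ℂ) from x.2)
    have : x = (q : F 0) := by apply Subtype.ext; rw [← hq]; simp
    exact ⟨q, by rw [this]; simp⟩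
  | succ n ih =>
    obtain ⟨⟨a, b⟩, ha, hb, e⟩ := (stepF n).ex' x
    obtain ⟨r1, h1⟩ := ih (φ.comp (IntermediateField.inclusion (stepF n).le).toRingHom) ⟨a, ha⟩
    obtain ⟨r2, h2⟩ := ih (φ.comp (IntermediateField.inclusion (stepF n).le).toRingHom) ⟨b, hb⟩
    obtain ⟨r3, h3, -⟩ := emb_c (n + 1) φ
    refine ⟨r1 + r2 * r3, ?_⟩
    have : x = IntermediateField.inclusion (stepF n).le ⟨a, ha⟩ +
        IntermediateField.inclusion (stepF n).le ⟨b, hb⟩ * (c (n + 1) : F (n + 1)) := by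
      apply Subtype.ext
      rw [e]
      push_cast
      rw [← v_apply, v_c]; rfl
    rw [this, map_add, map_mul, h3]
    push_cast
    rw [← h1, ← h2]; rfl

end TwoCl

set_option linter.unusedSectionVars false
set_option linter.style.haveILetI false
set_option linter.unusedVariables false

open IntermediateField NumberField

namespace TwoCl

/-- The induction statement. -/
structure Web (n : ℕ) : Prop where
  odd : Odd (Nat.card (ClassGroup (𝓞 (F n))))
  uu : ∀ ε : (𝓞 (F n))ˣ, ∃ u ∈ U n, ∃ η, ε = u * η ^ 2
  tp : ∀ ε : (𝓞 (F n))ˣ, TP (ε : 𝓞 (F n)) → ∃ η, ε = η ^ 2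

/-- the ring of integers of `F 0` -/
noncomputable def eqZ : 𝓞 (F 0) ≃+* ℤ :=
  (RingOfIntegers.mapRingEquiv (IntermediateField.botEquiv ℚ ℂ).toRingEquiv).trans
    Rat.ringOfIntegersEquiv

theorem unit_F0 (ε : (𝓞 (F 0))ˣ) : ε = 1 ∨ ε = -1 := by
  rcases Int.units_eq_one_or (Units.map (eqZ : _ →* _) ε) with h | h
  · left
    apply Units.ext
    apply eqZ.injective
    have := congrArg Units.val h
    simpa using this
  · right
    apply Units.ext
    apply eqZ.injective
    have := congrArg Units.val h
    simpa using this

theorem web_zero : Web 0 where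
  odd := by
    haveI : IsPrincipalIdealRing (𝓞 (F 0)) :=
      IsPrincipalIdealRing.of_surjective (eqZ.symm : ℤ →+* 𝓞 (F 0)) eqZ.symm.surjective
    have h1 : Nat.card (ClassGroup (𝓞 (F 0))) = 1 := by
      letI := Fintype.ofFinite (ClassGroup (𝓞 (F 0)))
      rw [Nat.card_eq_fintype_card]
      convert card_classGroup_eq_one (R := 𝓞 (F 0))
    rw [h1]; exact odd_one
  uu ε := ⟨ε, by
    rcases unit_F0 ε with rfl | rfl
    · exact one_mem _
    · exact neg_one_mem_U 0, 1, by simp⟩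
  tp ε hε := by
    rcases unit_F0 ε with rfl | rfl
    · exact ⟨1, by simp⟩
    · exfalso
      obtain ⟨r, hr, e⟩ := hε (algebraMap (F 0) ℂ)
      have : ((-1 : ℝ) : ℂ) = r := by rw [← e]; simp
      have : (-1 : ℝ) = r := by exact_mod_cast this
      linarith

theorem unit_norm {n : ℕ} (W : Web n) (ε : (𝓞 (F n))ˣ) :
    ∃ w : (𝓞 (F (n + 1)))ˣ, w * sU n w = iU n ε := by
  obtain ⟨u, hu, η, rfl⟩ := W.uu ε
  obtain ⟨w, -, hw⟩ := U_norm n u hu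
  refine ⟨w * iU n η, ?_⟩
  have h1 : sU n (iU n η) = iU n η := by ext; simp [(qdF n).fix]
  rw [map_mul, map_mul, map_pow, h1, ← hw, sq]
  exact mul_mul_mul_comm _ _ _ _

theorem norm_unit_U {n : ℕ} (ε : (𝓞 (F (n + 1)))ˣ) : ∃ e, iU n e = ε * sU n ε := by
  obtain ⟨e, he⟩ := (qdF n).norm_unit ε
  exact ⟨e, Units.ext he⟩

theorem corUF' (n : ℕ) (hodd : Odd (Nat.card (ClassGroup (𝓞 (F n))))) (η : (𝓞 (F (n + 1)))ˣ)
    (hη : η * sU n η = 1) :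
    ∃ w e : (𝓞 (F (n + 1)))ˣ, (e = 1 ∨ e = -1) ∧ η * sU n w = e * w := by
  obtain ⟨w, e, he, h⟩ := corUF n hodd η (by
    have := congrArg Units.val hη
    simpa using this)
  exact ⟨w, e, he, Units.ext (by simpa using h)⟩

/-- the key decomposition: if `N ε = N (ρ)` then `ε = ± ρ w² / N w`. -/
theorem decomp {n : ℕ} (W : Web n) (ε ρ : (𝓞 (F (n + 1)))ˣ) (h : ε * sU n ε = ρ * sU n ρ) :
    ∃ (w : (𝓞 (F (n + 1)))ˣ) (f : (𝓞 (F n))ˣ), ε = ρ * iU n f * w ^ 2 := by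
  obtain ⟨w, e, he, h1⟩ := corUF' n W.odd (ε * ρ⁻¹) (by
    rw [map_mul, map_inv, mul_mul_mul_comm, h, mul_mul_mul_comm]
    simp)
  obtain ⟨f, hf⟩ := norm_unit_U w
  have key : ε * iU n f = ρ * e * w ^ 2 := by
    rw [hf, sq]
    calc ε * (w * sU n w) = ρ * (ε * ρ⁻¹ * sU n w) * w := by
          rw [mul_comm w]; simp only [← mul_assoc]
          rw [mul_comm ρ ε, mul_assoc ε ρ, mul_inv_cancel, mul_one]
      _ = _ := by rw [h1]; simp only [mul_assoc]
  obtain ⟨e', he'⟩ : ∃ e', iU n e' = e := by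
    rcases he with rfl | rfl
    · exact ⟨1, map_one _⟩
    · exact ⟨-1, by ext; simp⟩
  refine ⟨w, e' * f⁻¹, ?_⟩
  rw [map_mul, map_inv, he']
  apply mul_right_cancel (b := iU n f)
  rw [key]
  calc ρ * e * w ^ 2 = ρ * e * w ^ 2 * ((iU n f)⁻¹ * iU n f) := by rw [inv_mul_cancel, mul_one]
    _ = _ := by
      simp only [mul_assoc]
      congr 2
      rw [← mul_assoc, mul_comm (w ^ 2), mul_assoc]

theorem tp_norm {n : ℕ} {ε : (𝓞 (F (n + 1)))ˣ} (hε : TP (ε : 𝓞 (F (n + 1)))) {e : (𝓞 (F n))ˣ}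
    (he : iU n e = ε * sU n ε) : TP (e : 𝓞 (F n)) := by
  intro φ
  obtain ⟨ψ, hψ⟩ := exists_ext (stepF n) φ
  obtain ⟨r, hr, e1⟩ := hε ψ
  obtain ⟨r', hr', e2⟩ := hε (ψ.comp (stepF n).conj)
  refine ⟨r * r', mul_pos hr hr', ?_⟩
  rw [← hψ]
  have h1 := congrArg (fun x : (𝓞 (F (n + 1)))ˣ => ψ ((x : 𝓞 (F (n + 1))) : F (n + 1))) he
  simp only [Units.val_mul, map_mul] at h1
  push_cast
  rw [← e1, ← e2]
  exact h1

theorem tp_of_mul_sq {n : ℕ} {g : (𝓞 (F n))ˣ} {ε w : (𝓞 (F (n + 1)))ˣ}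
    (hε : TP (ε : 𝓞 (F (n + 1)))) (h : ε = iU n g * w ^ 2) : TP (g : 𝓞 (F n)) := by
  intro φ
  obtain ⟨ψ, hψ⟩ := exists_ext (stepF n) φ
  obtain ⟨r, hr, e1⟩ := hε ψ
  obtain ⟨t, ht⟩ := emb_real (n + 1) ψ ((w : 𝓞 (F (n + 1))) : F (n + 1))
  obtain ⟨g', hg⟩ := emb_real n φ ((g : 𝓞 (F n)) : F n)
  have h1 := congrArg (fun x : (𝓞 (F (n + 1)))ˣ => ψ ((x : 𝓞 (F (n + 1))) : F (n + 1))) h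
  simp only [Units.val_mul, map_mul, Units.val_pow_eq_pow_val, map_pow] at h1
  have h2 : ψ (((iU n g : (𝓞 (F (n + 1)))ˣ) : 𝓞 (F (n + 1))) : F (n + 1)) = g' := by
    rw [← hg, ← hψ]; rfl
  rw [e1, h2, ht] at h1
  have h3 : r = g' * t ^ 2 := by exact_mod_cast h1
  refine ⟨g', ?_, hg⟩
  by_contra hneg
  have : g' * t ^ 2 ≤ 0 := mul_nonpos_of_nonpos_of_nonneg (not_lt.1 hneg) (sq_nonneg t)
  linarith

theorem fixed_range {n : ℕ} (W : Web n) {x : ClassGroup (𝓞 (F (n + 1)))}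
    (hx : sCl (sF n) x = x) : ∃ d, clMap (iF n) (qdF n).inj d = x := by
  have h1 : x ∈ (qdF n).strong := by
    apply (qdF n).fixed_mem_strong _ hx
    intro ε _
    obtain ⟨w, hw⟩ := unit_norm W ε
    exact ⟨w, congrArg Units.val hw⟩
  have h2 : (qdF n).strong ≤ (clMap (iF n) (qdF n).inj).range := by
    refine sup_le le_rfl ?_
    rw [Subgroup.closure_le]
    rintro y ⟨P, hP, rfl⟩
    have : cl P hP.2.1 = 1 := (cl_eq_one_iff _).2 ⟨_, (prime_c n).ne_zero, ramF n P hP⟩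
    rw [this]; exact one_mem _
  exact h2 h1

theorem web_succ {n : ℕ} (W : Web n) : Web (n + 1) where
  odd := by
    apply odd_card_of
    intro x hx
    have h1 := (qdF n).s_eq_of_sq W.odd hx
    obtain ⟨d, rfl⟩ := fixed_range W h1
    refine eq_one_of_odd W.odd hx ?_
    rw [← map_pow, pow_card_eq_one', map_one]
  uu ε := by
    obtain ⟨e, he⟩ := norm_unit_U ε
    obtain ⟨u, hu, η, rfl⟩ := W.uu e
    obtain ⟨u', hu', hn⟩ := U_norm n u hu
    have h1 : sU n (iU n η) = iU n η := by ext; simp [(qdF n).fix]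
    obtain ⟨w, f, hw⟩ := decomp W ε (u' * iU n η) (by
      rw [← he, map_mul, map_mul, map_pow, h1, ← hn, sq]
      exact (mul_mul_mul_comm _ _ _ _))
    obtain ⟨u2, hu2, η2, h2⟩ := W.uu (η * f)
    refine ⟨u' * iU n u2, mul_mem hu' (U_incl n _ hu2), iU n η2 * w, ?_⟩
    rw [hw, mul_assoc u', ← map_mul, h2, map_mul, map_pow, mul_pow]
    simp only [mul_assoc]
  tp ε hε := by
    obtain ⟨e, he⟩ := norm_unit_U ε
    obtain ⟨η, rfl⟩ := W.tp e (tp_norm hε he)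
    have h1 : sU n (iU n η) = iU n η := by ext; simp [(qdF n).fix]
    obtain ⟨w, f, hw⟩ := decomp W ε (iU n η) (by rw [← he, map_pow, h1, sq])
    rw [← map_mul] at hw
    obtain ⟨g, hg⟩ := W.tp _ (tp_of_mul_sq hε hw)
    exact ⟨iU n g * w, by rw [hw, hg, map_pow, mul_pow]⟩

theorem web (n : ℕ) : Web n := by
  induction n with
  | zero => exact web_zero
  | succ n ih => exact web_succ ih

end TwoCl

set_option linter.unusedSectionVars false
set_option linter.style.haveILetI false
set_option linter.unusedVariables false

open IntermediateField NumberField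

namespace TwoCl

/-- square root of `-d` -/
noncomputable def sd (d : ℕ) : ℂ := Complex.I * (Real.sqrt d : ℂ)

theorem sd_sq (d : ℕ) : sd d ^ 2 = -(d : ℂ) := by
  have h : ((Real.sqrt d : ℝ) : ℂ) ^ 2 = d := by
    have := Real.sq_sqrt (Nat.cast_nonneg (α := ℝ) d)
    exact_mod_cast this
  rw [sd, mul_pow, h, Complex.I_sq]; ring

theorem sd_sq_mem (d n : ℕ) : sd d ^ 2 ∈ F n := by
  rw [sd_sq]; exact neg_mem (_root_.natCast_mem _ d)

theorem sd_int (d : ℕ) : IsIntegral ℤ (sd d) := by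
  apply IsIntegral.of_pow (n := 2) (by norm_num)
  rw [sd_sq]
  exact (isIntegral_natCast _ d).neg
where
  isIntegral_natCast (R : Type) [CommRing R] (d : ℕ) {A : Type} [CommRing A] [Algebra R A] :
      IsIntegral R (d : A) := by
    have : (d : A) = algebraMap R A d := by simp
    rw [this]; exact isIntegral_algebraMap

/-- the fields `K` -/
noncomputable def K (d n : ℕ) : IntermediateField ℚ ℂ := adj (F n) (sd d) (sd_sq_mem d n)

instance nfK (d n : ℕ) : NumberField (K d n) := by
  by_cases h : sd d ∈ F n
  · have : K d n = F n := by
      apply le_antisymm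
      · rintro z ⟨a, ha, b, hb, rfl⟩
        exact add_mem ha (mul_mem hb h)
      · exact le_adj
    rw [this]; exact nfF n
  · exact (step_adj (hs := sd_sq_mem d n) h).finite

theorem sd_re (d : ℕ) : (sd d).re = 0 := by simp [sd]

theorem sd_im (d : ℕ) (hd : 0 < d) : (sd d).im ≠ 0 := by
  have : (0 : ℝ) < d := by exact_mod_cast hd
  simp [sd]
  omega

theorem sd_notMem (d n : ℕ) (hd : 0 < d) : sd d ∉ F n := fun h => sd_im d hd (F_real n _ h)

theorem stepK {d : ℕ} (hd : 0 < d) (n : ℕ) : Step (F n) (K d n) (sd d) :=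
  step_adj (sd_notMem d n hd)

theorem real_K {d : ℕ} (hd : 0 < d) (n : ℕ) {z : ℂ} (hz : z ∈ K d n) (hr : z.im = 0) :
    z ∈ F n := by
  obtain ⟨a, ha, b, hb, rfl⟩ := hz
  have h1 := F_real n _ ha
  have h2 := F_real n _ hb
  have h3 : b.re * (sd d).im = 0 := by
    simpa [h1, h2, sd_re] using hr
  have h4 : b.re = 0 := (mul_eq_zero.1 h3).resolve_right (sd_im d hd)
  have : b = 0 := Complex.ext h4 h2
  rw [this]; simpa using ha

theorem cc_notMem_K {d : ℕ} (hd : 0 < d) (n : ℕ) : cc (n + 1) ∉ K d n := fun h =>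
  cc_notMem n (real_K hd n h (by rw [cc]; simp))

theorem stepKK {d : ℕ} (hd : 0 < d) (n : ℕ) : Step (K d n) (K d (n + 1)) (cc (n + 1)) where
  le := by
    rintro z ⟨a, ha, b, hb, rfl⟩
    exact ⟨a, (stepF n).le ha, b, (stepF n).le hb, rfl⟩
  sq := le_adj (sq_mem n)
  mem := le_adj (cc_mem (n + 1))
  notMem := cc_notMem_K hd n
  ex := by
    rintro z ⟨a, ha, b, hb, rfl⟩
    obtain ⟨a1, ha1, a2, ha2, rfl⟩ := (stepF n).ex a ha
    obtain ⟨b1, hb1, b2, hb2, rfl⟩ := (stepF n).ex b hb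
    exact ⟨a1 + b1 * sd d, ⟨a1, ha1, b1, hb1, rfl⟩, a2 + b2 * sd d, ⟨a2, ha2, b2, hb2, rfl⟩,
      by ring⟩

theorem qdK {d : ℕ} (hd : 0 < d) (n : ℕ) : QD (incl (stepK hd n).le) (stepK hd n).σ :=
  (stepK hd n).qd (sd_int d)

theorem qdKK {d : ℕ} (hd : 0 < d) (n : ℕ) : QD (incl (stepKK hd n).le) (stepKK hd n).σ :=
  (stepKK hd n).qd (cc_int _)

/-- element `sd` as an integer -/
theorem exists_sd (d n : ℕ) : ∃ x : 𝓞 (K d n), v x = sd d := exists_v s_mem_adj (sd_int d)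

/-- compatibility of the two conjugations on `F` -/
theorem tau_F {d : ℕ} (hd : 0 < d) (n : ℕ) (x : 𝓞 (F (n + 1))) :
    (stepKK hd n).σ (incl (stepK hd (n + 1)).le x) = incl (stepK hd (n + 1)).le (sF n x) := by
  obtain ⟨a, ha, b, hb, e⟩ := (stepF n).ex _ (v_mem x)
  apply v_inj
  rw [(stepKK hd n).v_σ (a := a) (b := b) (le_adj ha) (le_adj hb) (by rw [v_incl, e]), v_incl,
    (stepF n).v_σ ha hb e]

/-- conjugations commute with inclusions -/
theorem sigma_incl {d : ℕ} (hd : 0 < d) (n : ℕ) (x : 𝓞 (K d n)) :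
    (stepK hd (n + 1)).σ (incl (stepKK hd n).le x) = incl (stepKK hd n).le ((stepK hd n).σ x) := by
  obtain ⟨a, ha, b, hb, e⟩ := (stepK hd n).ex _ (v_mem x)
  apply v_inj
  rw [(stepK hd (n + 1)).v_σ (a := a) (b := b) ((stepF n).le ha) ((stepF n).le hb)
    (by rw [v_incl, e]), v_incl, (stepK hd n).v_σ ha hb e]

theorem conj_of_sq {z : ℂ} {t : ℝ} (ht : 0 ≤ t) (h : z ^ 2 = -(t : ℂ)) :
    (starRingEnd ℂ) z = - z := by
  obtain ⟨r, hr, -⟩ := sq_real (z := Complex.I * z) t ht (by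
    rw [mul_pow, Complex.I_sq, h]; ring)
  have : z = - Complex.I * r := by rw [← hr]; linear_combination z * Complex.I_sq
  rw [this]; simp

theorem emb_conj {d : ℕ} (hd : 0 < d) (n : ℕ) (φ : K d n →+* ℂ) (x : 𝓞 (K d n)) :
    φ ((stepK hd n).σ x : K d n) = (starRingEnd ℂ) (φ (x : K d n)) := by
  obtain ⟨⟨a, b⟩, ha, hb, e⟩ := (stepK hd n).ex' (x : K d n)
  simp only at ha hb e
  set inc := (IntermediateField.inclusion (stepK hd n).le).toRingHom with hinc
  obtain ⟨r1, h1⟩ := emb_real n (φ.comp inc) ⟨a, ha⟩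
  obtain ⟨r2, h2⟩ := emb_real n (φ.comp inc) ⟨b, hb⟩
  obtain ⟨y, hy⟩ := exists_sd d n
  have hx : (x : K d n) = inc ⟨a, ha⟩ + inc ⟨b, hb⟩ * (y : K d n) := by
    apply Subtype.ext
    rw [e]
    push_cast
    rw [← v_apply, hy]; rfl
  have hx' : ((stepK hd n).σ x : K d n) = inc ⟨a, ha⟩ - inc ⟨b, hb⟩ * (y : K d n) := by
    apply Subtype.ext
    rw [← v_apply, (stepK hd n).v_σ ha hb e]
    push_cast
    rw [← v_apply, hy]; rfl
  have hy2 : φ (y : K d n) ^ 2 = -((d : ℝ) : ℂ) := by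
    have : (y : K d n) ^ 2 = - (d : K d n) := by
      apply Subtype.ext
      push_cast
      rw [← v_apply, hy, sd_sq]
    rw [← map_pow, this]; simp
  have hc := conj_of_sq (Nat.cast_nonneg d) hy2
  rw [hx, hx', map_sub, map_add, map_mul, map_add, map_mul, hc]
  rw [RingHom.comp_apply] at h1 h2
  rw [h1, h2, Complex.conj_ofReal, Complex.conj_ofReal]; ring

theorem TP_of_norm {d : ℕ} (hd : 0 < d) (n : ℕ) {e : 𝓞 (F n)} {a b : 𝓞 (K d n)} (ha : a ≠ 0)
    (hb : b ≠ 0) (h : a * (stepK hd n).σ a = incl (stepK hd n).le e * (b * (stepK hd n).σ b)) :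
    TP e := by
  intro φ
  obtain ⟨ψ, hψ⟩ := exists_ext (stepK hd n) φ
  have key : ∀ x : 𝓞 (K d n), ψ ((x * (stepK hd n).σ x : 𝓞 (K d n)) : K d n) =
      ((Complex.normSq (ψ (x : K d n)) : ℝ) : ℂ) := by
    intro x
    have : ((x * (stepK hd n).σ x : 𝓞 (K d n)) : K d n) = (x : K d n) * ((stepK hd n).σ x : K d n) :=
      map_mul _ _ _
    rw [this, map_mul, emb_conj hd, Complex.mul_conj]
  have hpos : ∀ x : 𝓞 (K d n), x ≠ 0 → 0 < Complex.normSq (ψ (x : K d n)) := by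
    intro x hx
    rw [Complex.normSq_pos, Ne, map_eq_zero]
    simpa using hx
  have h1 := congrArg (fun x : 𝓞 (K d n) => ψ (x : K d n)) h
  have hm : ∀ x y : 𝓞 (K d n), ψ ((x * y : 𝓞 (K d n)) : K d n) = ψ (x : K d n) * ψ (y : K d n) := by
    intro x y
    have : ((x * y : 𝓞 (K d n)) : K d n) = (x : K d n) * (y : K d n) := map_mul _ _ _
    rw [this, map_mul]
  beta_reduce at h1
  rw [key, hm, key] at h1
  have h2 : ψ (algebraMap (𝓞 (K d n)) (K d n) (incl (stepK hd n).le e)) = φ (e : F n) := hψ _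
  rw [h2] at h1
  refine ⟨Complex.normSq (ψ (a : K d n)) / Complex.normSq (ψ (b : K d n)),
    div_pos (hpos a ha) (hpos b hb), ?_⟩
  have := (hpos b hb).ne'
  push_cast
  rw [eq_div_iff (by exact_mod_cast this)]
  exact h1.symm

/-- divisibility between rational integers -/
theorem nat_dvd {n a b : ℕ} (h : (a : 𝓞 (F n)) ∣ b) : a ∣ b := by
  have h1 : Ideal.span {(b : 𝓞 (F n))} ≤ Ideal.span {(a : 𝓞 (F n))} :=
    Ideal.span_singleton_le_span_singleton.2 h
  have h2 := Ideal.absNorm_dvd_absNorm_of_le h1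
  rw [absNorm_l, absNorm_l] at h2
  exact (Nat.pow_dvd_pow_iff (by positivity)).1 h2

end TwoCl

set_option linter.unusedSectionVars false
set_option linter.style.haveILetI false
set_option linter.unusedVariables false

open IntermediateField NumberField

namespace TwoCl

/-- hypotheses on the primes -/
structure PQ (p q : ℕ) : Prop where
  hp : p.Prime
  hq : q.Prime
  hp8 : p % 8 = 5
  hq8 : q % 8 = 3

namespace PQ
variable {p q : ℕ}

theorem ne (h : PQ p q) : p ≠ q := by
  intro e; have := h.hp8; have := h.hq8; omega

theorem pos (h : PQ p q) : 0 < p * q := Nat.mul_pos h.hp.pos h.hq.pos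

theorem mod8 (h : PQ p q) : (p * q) % 8 = 7 := by
  rw [Nat.mul_mod, h.hp8, h.hq8]

theorem prime_p (h : PQ p q) (n : ℕ) : Prime (p : 𝓞 (F n)) := inert p h.hp (Or.inr h.hp8) n

theorem prime_q (h : PQ p q) (n : ℕ) : Prime (q : 𝓞 (F n)) := inert q h.hq (Or.inl h.hq8) n

end PQ

theorem exists_prime_order {G : Type*} [Monoid G] {α : G} {m : ℕ} (hm : 0 < m) (h : α ^ m = 1)
    (h2 : α ^ 2 ≠ 1) : ∃ k l : ℕ, l.Prime ∧ (α ^ k) ^ 2 ≠ 1 ∧ ((α ^ k) ^ 2) ^ l = 1 := by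
  have hf : IsOfFinOrder (α ^ 2) := (isOfFinOrder_iff_pow_eq_one.2 ⟨m, hm, h⟩).pow
  have h0 : 0 < orderOf (α ^ 2) := hf.orderOf_pos
  have h1 : orderOf (α ^ 2) ≠ 1 := by rwa [Ne, orderOf_eq_one_iff]
  obtain ⟨l, hl, k, hk⟩ := Nat.exists_prime_and_dvd h1
  have hk0 : 0 < k := by
    rcases Nat.eq_zero_or_pos k with rfl | h
    · rw [hk] at h0; simp at h0
    · exact h
  have e : (α ^ k) ^ 2 = (α ^ 2) ^ k := by rw [← pow_mul, ← pow_mul, mul_comm]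
  refine ⟨k, l, hl, ?_, ?_⟩
  · rw [e]
    apply pow_ne_one_of_lt_orderOf hk0.ne'
    rw [hk]; have := hl.two_le; nlinarith
  · rw [e, ← pow_mul, mul_comm k l, ← hk, pow_orderOf_eq_one]

theorem sub_one_dvd {R : Type*} [CommRing R] [IsDomain R] {z : R} {l : ℕ} (h : z ^ l = 1)
    (h1 : z ≠ 1) : z - 1 ∣ (l : R) := by
  have hs : ∑ i ∈ Finset.range l, z ^ i = 0 := by
    have := mul_neg_geom_sum z l
    rw [h, sub_self] at this
    exact (mul_eq_zero.1 this).resolve_left (sub_ne_zero.2 h1.symm)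
  have h2 : z - 1 ∣ ∑ i ∈ Finset.range l, (z ^ i - 1) :=
    Finset.dvd_sum fun i _ => sub_one_dvd_pow_sub_one' z i
  rw [Finset.sum_sub_distrib, hs, zero_sub, dvd_neg] at h2
  simpa using h2
where
  sub_one_dvd_pow_sub_one' (z : R) (i : ℕ) : z - 1 ∣ z ^ i - 1 := by
    simpa using sub_dvd_pow_sub_pow z 1 i

theorem QD.dvd_of {A B : Type*} [CommRing A] [CommRing B] [IsDedekindDomain A] [IsDedekindDomain B]
    [Module.Free ℤ A] [Module.Finite ℤ A] [Module.Free ℤ B] [Module.Finite ℤ B]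
    {i : A →+* B} {s : B ≃+* B} (h : QD i s) {a b : A} (ha : a ≠ 0) (hd : i a ∣ i b) : a ∣ b := by
  obtain ⟨y, hy⟩ := hd
  have ha' : i a ≠ 0 := by rwa [Ne, map_eq_zero_iff i h.inj]
  have hs : s y = y := by
    have := congrArg s hy
    rw [map_mul, h.fix, h.fix, hy] at this
    exact (mul_left_cancel₀ ha' this).symm
  obtain ⟨z, rfl⟩ := h.mem y hs
  exact ⟨z, h.inj (by rw [hy, map_mul])⟩

theorem no_root {p q : ℕ} (h : PQ p q) (n : ℕ) {β : 𝓞 (K (p * q) n)} {l : ℕ} (hl : l.Prime)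
    (hββ : β * (stepK h.pos n).σ β = 1) (h1 : β ^ 2 ≠ 1) (h2 : (β ^ 2) ^ l = 1) : False := by
  set σ := (stepK h.pos n).σ with hσ
  have Q : QD (incl (stepK h.pos n).le) σ := qdK h.pos n
  set i := incl (stepK h.pos n).le with hi
  have hx : σ (β - σ β) = - (β - σ β) := by rw [map_sub, Q.inv]; ring
  obtain ⟨D, hD⟩ := exists_sd (p * q) n
  have hσD : σ D = - D := (stepK h.pos n).σ_s hD
  have hD2 : D ^ 2 = - i ((p * q : ℕ) : 𝓞 (F n)) := by
    apply v_inj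
    rw [map_pow, hD, sd_sq]; simp
  obtain ⟨y, hy⟩ := Q.mem ((β - σ β) * D) (by rw [map_mul, hx, hσD]; ring)
  obtain ⟨δ, hδ⟩ := Q.mem ((β - σ β) ^ 2) (by rw [map_pow, hx]; ring)
  have hmul : (β - σ β) * β = β ^ 2 - 1 := by rw [← hββ]; ring
  have hne : β - σ β ≠ 0 := by
    intro h0; rw [h0, zero_mul] at hmul
    exact h1 (by linear_combination -hmul)
  have hδ0 : δ ≠ 0 := by
    rintro rfl
    rw [map_zero] at hδ
    exact pow_ne_zero 2 hne hδ.symm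
  have hdl : δ ∣ (l : 𝓞 (F n)) ^ 2 := by
    apply Q.dvd_of hδ0
    rw [hδ, map_pow, map_natCast]
    apply pow_dvd_pow_of_dvd
    exact (Dvd.intro _ hmul).trans (sub_one_dvd h2 h1)
  have key : y ^ 2 = - ((p : 𝓞 (F n)) * q * δ) := by
    apply Q.inj
    rw [map_pow, hy, map_neg, map_mul, hδ, mul_pow, hD2]
    push_cast; ring
  have hl' : ∀ r : ℕ, r.Prime → Prime (r : 𝓞 (F n)) → (r : 𝓞 (F n)) ∣ δ → r = l := by
    intro r hr hr' hrd
    have := nat_dvd (hr'.dvd_of_dvd_pow (hrd.trans hdl))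
    exact (Nat.prime_dvd_prime_iff_eq hr hl).1 this
  have hpq : ∀ r r' : ℕ, r.Prime → r'.Prime → r ≠ r' → Prime (r : 𝓞 (F n)) → r ≠ l →
      y ^ 2 = - ((r : 𝓞 (F n)) * r' * δ) → False := by
    intro r r' hr hr' hrr hrp hrl e
    refine parity (u := r' * δ) (v := -1) (x := 1) (y := y) hrp ?_ ?_ one_ne_zero ?_
    · intro hd
      rcases hrp.dvd_or_dvd hd with hd | hd
      · exact hrr ((Nat.prime_dvd_prime_iff_eq hr hr').1 (nat_dvd hd))
      · exact hrl (hl' r hr hrp hd)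
    · intro hd; exact hrp.not_isUnit (isUnit_of_dvd_unit hd (by simp))
    · rw [e]; ring
  by_cases hpl : p = l
  · exact hpq q p h.hq h.hp h.ne.symm (h.prime_q n) (fun e => h.ne (hpl.trans e.symm))
      (by rw [key]; ring)
  · exact hpq p q h.hp h.hq h.ne (h.prime_p n) hpl key

theorem unit_eq {p q : ℕ} (h : PQ p q) (n : ℕ) (ε : (𝓞 (K (p * q) n))ˣ) :
    ∃ e : (𝓞 (F n))ˣ, (ε : 𝓞 (K (p * q) n)) = incl (stepK h.pos n).le e := by
  set σ := (stepK h.pos n).σ with hσ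
  have Q : QD (incl (stepK h.pos n).le) σ := qdK h.pos n
  set i := incl (stepK h.pos n).le with hi
  obtain ⟨e, he⟩ := Q.norm_unit ε
  have hTP : TP (e : 𝓞 (F n)) := TP_of_norm h.pos n (a := ε) (b := 1) ε.ne_zero one_ne_zero
    (by rw [map_one, one_mul, mul_one]; exact he.symm)
  obtain ⟨η, hη⟩ := (web n).tp e hTP
  set iη : (𝓞 (K (p * q) n))ˣ := Units.map (i : _ →* _) η with hiη
  set α := ε * iη⁻¹ with hα
  have hiη' : ((iη : (𝓞 (K (p * q) n))ˣ) : 𝓞 (K (p * q) n)) = i η := rfl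
  have hεα : (ε : 𝓞 (K (p * q) n)) = α * i η := by
    rw [← hiη', hα]; push_cast; simp
  have hαα : (α : 𝓞 (K (p * q) n)) * σ α = 1 := by
    have h0 : i (η : 𝓞 (F n)) ≠ 0 := by rw [← hiη']; exact iη.ne_zero
    apply mul_right_cancel₀ (mul_ne_zero h0 h0)
    rw [one_mul]
    have : i (e : 𝓞 (F n)) = i η * i η := by rw [hη]; push_cast; rw [map_pow, sq]
    have h3 := he
    rw [this, hεα, map_mul, Q.fix] at h3
    linear_combination -h3
  have hroot : ∃ m : ℕ, 0 < m ∧ (α : 𝓞 (K (p * q) n)) ^ m = 1 := by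
    obtain ⟨m, hm, hm1⟩ := NumberField.Embeddings.pow_eq_one_of_norm_eq_one (K (p * q) n) ℂ
      (x := ((α : 𝓞 (K (p * q) n)) : K (p * q) n)) (RingOfIntegers.isIntegral_coe _) (by
        intro φ
        have h1 := congrArg (fun x : 𝓞 (K (p * q) n) => φ (x : K (p * q) n)) hαα
        have hm : ∀ x y : 𝓞 (K (p * q) n), φ ((x * y : 𝓞 (K (p * q) n)) : K (p * q) n) =
            φ (x : K (p * q) n) * φ (y : K (p * q) n) := by
          intro x y
          have : ((x * y : 𝓞 (K (p * q) n)) : K (p * q) n) = (x : K (p * q) n) * (y : K (p * q) n) :=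
            map_mul _ _ _
          rw [this, map_mul]
        beta_reduce at h1
        rw [hm, hσ, emb_conj h.pos, Complex.mul_conj] at h1
        have h2 : Complex.normSq (φ ((α : 𝓞 (K (p * q) n)) : K (p * q) n)) = 1 := by
          have h3 : φ ((1 : 𝓞 (K (p * q) n)) : K (p * q) n) = ((1 : ℝ) : ℂ) := by simp
          rw [h3] at h1
          exact_mod_cast h1
        rw [Complex.normSq_eq_norm_sq] at h2
        exact (pow_eq_one_iff_of_nonneg (norm_nonneg _) two_ne_zero).1 h2)
    refine ⟨m, hm, RingOfIntegers.ext ?_⟩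
    push_cast
    simpa using hm1
  obtain ⟨m, hm, hm1⟩ := hroot
  have hα2 : (α : 𝓞 (K (p * q) n)) ^ 2 = 1 := by
    by_contra hne
    obtain ⟨k, l, hl, h1, h2⟩ := exists_prime_order hm hm1 hne
    exact no_root h n hl (by rw [map_pow, ← mul_pow, hαα, one_pow]) h1 h2
  rcases side hα2 with h1 | h1
  · exact ⟨η, by rw [hεα, h1, one_mul]⟩
  · exact ⟨-η, by rw [hεα, h1]; push_cast; rw [map_neg]; ring⟩
where
  side {R : Type} [CommRing R] [IsDomain R] {x : R} (h : x ^ 2 = 1) :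
      x = 1 ∨ x = -1 := by
    have : (x - 1) * (x + 1) = 0 := by linear_combination h
    rcases mul_eq_zero.1 this with h | h
    · left; linear_combination h
    · right; linear_combination h

end TwoCl

set_option linter.unusedSectionVars false
set_option linter.style.haveILetI false
set_option linter.unusedVariables false

open IntermediateField NumberField

namespace TwoCl

theorem eq_of_sq_of_le {R : Type*} [CommRing R] [IsDedekindDomain R] {I J : Ideal R} (hJ : J ≠ ⊥)
    (hle : I ≤ J) (h : I ^ 2 = J ^ 2) : I = J := by
  obtain ⟨X, rfl⟩ := Ideal.dvd_iff_le.2 hle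
  have h1 : J ^ 2 * X ^ 2 = J ^ 2 * 1 := by rw [← mul_pow, h, mul_one]
  have h2 : X ^ 2 = 1 := mul_left_cancel₀ (pow_ne_zero 2 hJ) h1
  have h3 : X = 1 := by
    have : IsUnit X := IsUnit.of_mul_eq_one X (by rw [← sq, h2])
    rw [Ideal.isUnit_iff] at this
    rw [this, Ideal.one_eq_top]
  rw [h3, mul_one]

theorem mul_le_of_mem {R : Type*} [CommRing R] [IsDedekindDomain R] {P P' : Ideal R}
    (hP : P.IsPrime) (hP' : P'.IsPrime) (h0 : P ≠ ⊥) (h0' : P' ≠ ⊥) (hne : P ≠ P') {x : R}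
    (hx : x ∈ P) (hx' : x ∈ P') : x ∈ P * P' := by
  have hc : IsCoprime P P' := by
    rw [Ideal.isCoprime_iff_sup_eq]
    exact (hP.isMaximal h0).coprime_of_ne (hP'.isMaximal h0') hne
  rw [Ideal.mul_eq_inf_of_isCoprime hc]
  exact ⟨hx, hx'⟩

theorem exists_prime_mem {R : Type*} [CommRing R] {x : R} (hx : ¬ IsUnit x) :
    ∃ P : Ideal R, P.IsPrime ∧ x ∈ P := by
  obtain ⟨P, hP, hle⟩ := Ideal.exists_le_maximal (Ideal.span {x}) (by
    rwa [Ne, Ideal.span_singleton_eq_top])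
  exact ⟨P, hP.isPrime, (Ideal.span_singleton_le_iff_mem _).1 hle⟩

theorem QD.not_unit {A B : Type*} [CommRing A] [CommRing B] [IsDedekindDomain A]
    [IsDedekindDomain B]
    [Module.Free ℤ A] [Module.Finite ℤ A] [Module.Free ℤ B] [Module.Finite ℤ B]
    {i : A →+* B} {s : B ≃+* B} (h : QD i s) {a : A} (ha : Prime a) : ¬ IsUnit (i a) := by
  intro hu
  apply ha.not_isUnit
  rw [isUnit_iff_dvd_one]
  apply h.dvd_of ha.ne_zero
  rw [map_one]; exact hu.dvd

theorem QD.comap_eq {A B : Type*} [CommRing A] [CommRing B] [IsDedekindDomain A]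
    [IsDedekindDomain B]
    [Module.Free ℤ A] [Module.Finite ℤ A] [Module.Free ℤ B] [Module.Finite ℤ B]
    {i : A →+* B} {s : B ≃+* B} (h : QD i s) {a : A} (ha : Prime a) {P : Ideal B} (hP : P.IsPrime)
    (hm : i a ∈ P) : (P.comap i).map i = Ideal.span {i a} := by
  have hp := (Ideal.span_singleton_prime ha.ne_zero).2 ha
  have hmax : (Ideal.span {a}).IsMaximal := hp.isMaximal (by simpa using ha.ne_zero)
  have : Ideal.span {a} = P.comap i := hmax.eq_of_le (hP.comap i).ne_top (by
    rw [Ideal.span_singleton_le_iff_mem]; exact hm)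
  rw [← this, Ideal.map_span, Set.image_singleton]

theorem QD.ne_bot_of_mem {A B : Type*} [CommRing A] [CommRing B] [IsDedekindDomain A]
    [IsDedekindDomain B]
    [Module.Free ℤ A] [Module.Finite ℤ A] [Module.Free ℤ B] [Module.Finite ℤ B]
    {i : A →+* B} {s : B ≃+* B} (h : QD i s) {a : A} (ha : a ≠ 0) {P : Ideal B}
    (hm : i a ∈ P) : P ≠ ⊥ := by
  rintro rfl
  exact ha (h.inj (by rw [map_zero]; exact hm))

/-- the integer `(1 + sqrt(-d))/2` -/
theorem exists_omega {d : ℕ} (hd : d % 8 = 7) (n : ℕ) :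
    ∃ w : 𝓞 (K d n), v w = (1 + sd d) / 2 := by
  apply exists_v
  · exact div_mem (add_mem (one_mem _) s_mem_adj) (_root_.natCast_mem _ 2)
  · refine ⟨Polynomial.X ^ 2 + (Polynomial.C (-1) * Polynomial.X +
      Polynomial.C (((d + 1) / 4 : ℕ) : ℤ)), ?_, ?_⟩
    · apply Polynomial.monic_X_pow_add
      compute_degree!
    · have h4 : (4 : ℂ) * (((d + 1) / 4 : ℕ) : ℂ) = d + 1 := by
        have : 4 * ((d + 1) / 4) = d + 1 := by omega
        exact_mod_cast this
      simp only [Polynomial.eval₂_add, Polynomial.eval₂_mul, Polynomial.eval₂_pow,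
        Polynomial.eval₂_X, Polynomial.eval₂_C]
      simp only [algebraMap_int_eq, eq_intCast, Int.cast_neg, Int.cast_one, Int.cast_natCast,
        map_natCast]
      linear_combination (1/4) * sd_sq d + (1/4) * h4

section
variable {p q : ℕ}

theorem omega_D (h : PQ p q) (n : ℕ) {w D : 𝓞 (K (p * q) n)} (hw : v w = (1 + sd (p * q)) / 2)
    (hD : v D = sd (p * q)) : (stepK h.pos n).σ w - w = - D := by
  apply v_inj
  rw [map_sub, (stepK h.pos n).v_σ (a := 1 / 2) (b := 1 / 2)
    (div_mem (one_mem _) (_root_.natCast_mem _ 2)) (div_mem (one_mem _) (_root_.natCast_mem _ 2))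
    (by rw [hw]; ring), map_neg, hw, hD]; ring

theorem D_sq (h : PQ p q) (n : ℕ) {D : 𝓞 (K (p * q) n)}
    (hD : v D = sd (p * q)) : D ^ 2 = - (incl (stepK h.pos n).le p * incl (stepK h.pos n).le q) := by
  apply v_inj
  rw [map_pow, hD, sd_sq]; simp

theorem ramK (h : PQ p q) (n : ℕ) {P : Ideal (𝓞 (K (p * q) n))} (hP : (qdK h.pos n).Ram P)
    {D : 𝓞 (K (p * q) n)} (hD : v D = sd (p * q)) :
    D ∈ P ∧ (incl (stepK h.pos n).le p ∈ P ∨ incl (stepK h.pos n).le q ∈ P) := by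
  obtain ⟨w, hw⟩ := exists_omega h.mod8 n
  have h1 : D ∈ P := by
    have := hP.2.2.2.2 w
    rw [omega_D h n hw hD] at this
    simpa using this
  refine ⟨h1, hP.1.mem_or_mem ?_⟩
  have h2 : D ^ 2 ∈ P := by rw [sq]; exact P.mul_mem_left _ h1
  rw [D_sq h n hD] at h2
  simpa using h2

theorem D_notMem (h : PQ p q) (n : ℕ) {D : 𝓞 (K (p * q) n)} (hD : v D = sd (p * q)) :
    D ∉ Ideal.span {incl (stepK h.pos n).le (p : 𝓞 (F n))} := by
  intro hm
  obtain ⟨y, hy⟩ := Ideal.mem_span_singleton.1 hm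
  have h1 := D_sq h n hD
  have hp := h.prime_p n
  have h2 : incl (stepK h.pos n).le (p : 𝓞 (F n)) ≠ 0 := by
    rw [Ne, map_eq_zero_iff _ (qdK h.pos n).inj]; exact hp.ne_zero
  have h3 : incl (stepK h.pos n).le (p : 𝓞 (F n)) ∣ incl (stepK h.pos n).le (q : 𝓞 (F n)) := by
    refine ⟨-y ^ 2, mul_left_cancel₀ h2 ?_⟩
    rw [hy] at h1
    linear_combination h1
  have h4 := nat_dvd ((qdK h.pos n).dvd_of hp.ne_zero h3)
  exact h.ne ((Nat.prime_dvd_prime_iff_eq h.hp h.hq).1 h4)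

/-- the ramified prime above `p` -/
theorem exists_ram_p (h : PQ p q) (n : ℕ) : ∃ P : Ideal (𝓞 (K (p * q) n)),
    (qdK h.pos n).Ram P ∧ P ^ 2 = Ideal.span {incl (stepK h.pos n).le (p : 𝓞 (F n))} := by
  have Q := qdK h.pos n
  obtain ⟨P, hP, hm⟩ := exists_prime_mem (Q.not_unit (h.prime_p n))
  have h0 := Q.ne_bot_of_mem (h.prime_p n).ne_zero hm
  obtain ⟨D, hD⟩ := exists_sd (p * q) n
  have hDP : D ∈ P := by
    have : D ^ 2 ∈ P := by
      rw [D_sq h n hD]; exact neg_mem (P.mul_mem_right _ hm)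
    exact hP.mem_of_pow_mem 2 this
  have hce := Q.comap_eq (h.prime_p n) hP hm
  rcases Q.trichotomy hP h0 with ⟨h1, h2⟩ | ⟨h1, h2⟩ | h1
  · exfalso
    apply D_notMem h n hD
    rw [← hce, ← h2]
    refine mul_le_of_mem hP (Ideal.map_isPrime_of_equiv _) h0 (Q.map_s_ne_bot h0) (Ne.symm h1) hDP ?_
    rw [Q.mem_map_s, (stepK h.pos n).σ_s hD]
    exact neg_mem hDP
  · exfalso
    apply D_notMem h n hD
    rw [← hce, ← h2]; exact hDP
  · exact ⟨P, h1, by rw [h1.2.2.2.1, hce]⟩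

theorem unit_hU (h : PQ p q) (n : ℕ) (ε : (𝓞 (F n))ˣ)
    (hε : ∃ a b : 𝓞 (K (p * q) n), b ≠ 0 ∧
      a * (stepK h.pos n).σ a = incl (stepK h.pos n).le ε * (b * (stepK h.pos n).σ b)) :
    ∃ u : (𝓞 (K (p * q) n))ˣ, u * (stepK h.pos n).σ u = incl (stepK h.pos n).le (ε : 𝓞 (F n)) := by
  obtain ⟨a, b, hb, e⟩ := hε
  have Q := qdK h.pos n
  have ha : a ≠ 0 := by
    rintro rfl
    have h1 : incl (stepK h.pos n).le (ε : 𝓞 (F n)) ≠ 0 := by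
      rw [Ne, map_eq_zero_iff _ Q.inj]; exact ε.ne_zero
    have h2 : (stepK h.pos n).σ b ≠ 0 := by simpa using hb
    rw [zero_mul] at e
    exact mul_ne_zero h1 (mul_ne_zero hb h2) e.symm
  obtain ⟨η, rfl⟩ := (web n).tp ε (TP_of_norm h.pos n ha hb e)
  refine ⟨Units.map (incl (stepK h.pos n).le : _ →* _) η, ?_⟩
  have : ((Units.map (incl (stepK h.pos n).le : _ →* _) η : (𝓞 (K (p * q) n))ˣ) : 𝓞 (K (p * q) n))
    = incl (stepK h.pos n).le η := rfl
  rw [this, Q.fix]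
  push_cast
  rw [map_pow, sq]

theorem two_tors (h : PQ p q) (n : ℕ) : ∃ g : ClassGroup (𝓞 (K (p * q) n)), g ^ 2 = 1 ∧
    ∀ x : ClassGroup (𝓞 (K (p * q) n)), x ^ 2 = 1 → x = 1 ∨ x = g := by
  have Q := qdK h.pos n
  obtain ⟨P, hP, hP2⟩ := exists_ram_p h n
  obtain ⟨D, hD⟩ := exists_sd (p * q) n
  have hp0 : incl (stepK h.pos n).le (p : 𝓞 (F n)) ≠ 0 := by
    rw [Ne, map_eq_zero_iff _ Q.inj]; exact (h.prime_p n).ne_zero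
  have hg : cl P hP.2.1 ^ 2 = 1 := by
    rw [sq, ← cl_mul, cl_eq_one_iff]
    exact ⟨_, hp0, by rw [← sq, hP2]⟩
  have hmemp : incl (stepK h.pos n).le (p : 𝓞 (F n)) ∈ P := by
    have : incl (stepK h.pos n).le (p : 𝓞 (F n)) ∈ P ^ 2 := by
      rw [hP2]; exact Ideal.mem_span_singleton_self _
    exact Ideal.pow_le_self two_ne_zero this
  have hD0 : D ≠ 0 := by
    rintro rfl
    exact D_notMem h n hD (zero_mem _)
  have hDsq : Ideal.span {D} ^ 2 = Ideal.span {incl (stepK h.pos n).le (p : 𝓞 (F n))} *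
      Ideal.span {incl (stepK h.pos n).le (q : 𝓞 (F n))} := by
    rw [Ideal.span_singleton_pow, D_sq h n hD, Ideal.span_singleton_neg,
      Ideal.span_singleton_mul_span_singleton]
  have hall : ∀ (P' : Ideal (𝓞 (K (p * q) n))) (hP' : Q.Ram P'), cl P' hP'.2.1 = cl P hP.2.1 := by
    intro P' hP'
    obtain ⟨hDP', hpq⟩ := ramK h n hP' hD
    by_cases hpP : incl (stepK h.pos n).le (p : 𝓞 (F n)) ∈ P'
    · apply cl_congr
      have e : P' ^ 2 = P ^ 2 := by
        rw [hP2, ← Q.comap_eq (h.prime_p n) hP'.1 hpP]; exact hP'.2.2.2.1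
      have : P ≤ P' := by
        have h1 : P ^ 2 ≤ P' := by rw [← e]; exact Ideal.pow_le_self two_ne_zero
        exact hP'.1.le_of_pow_le h1
      exact (eq_of_sq_of_le hP'.2.1 this e.symm).symm
    · have hqP := hpq.resolve_left hpP
      have e : P' ^ 2 = Ideal.span {incl (stepK h.pos n).le (q : 𝓞 (F n))} := by
        rw [← Q.comap_eq (h.prime_q n) hP'.1 hqP]; exact hP'.2.2.2.1
      have hne : P ≠ P' := by rintro rfl; exact hpP hmemp
      have hmem := mul_le_of_mem hP.1 hP'.1 hP.2.1 hP'.2.1 hne (ramK h n hP hD).1 hDP'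
      have hfin : Ideal.span {D} = P * P' := by
        apply eq_of_sq_of_le (mul_ne_zero hP.2.1 hP'.2.1)
        · rw [Ideal.span_singleton_le_iff_mem]; exact hmem
        · rw [hDsq, mul_pow, hP2, e]
      have h1 : cl P hP.2.1 * cl P' hP'.2.1 = 1 := by
        rw [← cl_mul, cl_eq_one_iff]; exact ⟨D, hD0, hfin.symm⟩
      rw [sq] at hg
      exact mul_left_cancel (h1.trans hg.symm)
  refine ⟨cl P hP.2.1, hg, fun x hx => ?_⟩
  have hs := Q.s_eq_of_sq (web n).odd hx
  have hst := Q.fixed_mem_strong (unit_hU h n) hs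
  have hle : Subgroup.closure {c | ∃ (P : Ideal (𝓞 (K (p * q) n))) (hP : Q.Ram P), c = cl P hP.2.1}
      ≤ Subgroup.zpowers (cl P hP.2.1) := by
    rw [Subgroup.closure_le]
    rintro _ ⟨P', hP', rfl⟩
    rw [hall P' hP']
    exact Subgroup.mem_zpowers _
  obtain ⟨y, ⟨d, rfl⟩, z, hz, rfl⟩ := Subgroup.mem_sup.1 hst
  obtain ⟨k, rfl⟩ := Subgroup.mem_zpowers_iff.1 (hle hz)
  have hgk : cl P hP.2.1 ^ k = 1 ∨ cl P hP.2.1 ^ k = cl P hP.2.1 := by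
    rcases Int.even_or_odd' k with ⟨m, rfl | rfl⟩
    · left; rw [zpow_mul, zpow_ofNat, hg, one_zpow]
    · right; rw [zpow_add, zpow_mul, zpow_ofNat, hg, one_zpow, one_mul, zpow_one]
  have hgk2 : (cl P hP.2.1 ^ k) ^ 2 = 1 := by
    rcases hgk with h | h <;> rw [h]
    · simp
    · exact hg
  rw [mul_pow, hgk2, mul_one] at hx
  have : clMap _ Q.inj d = 1 := eq_one_of_odd (web n).odd hx (by
    rw [← map_pow, pow_card_eq_one', map_one])
  rw [this, one_mul]
  exact hgk

end
end TwoCl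

set_option linter.unusedSectionVars false
set_option linter.style.haveILetI false
set_option linter.unusedVariables false

open IntermediateField NumberField

namespace TwoCl

theorem group_lemma {C D : Type*} [CommGroup C] [CommGroup D] [Finite C] [Finite D]
    (j : D →* C) (hj : Function.Injective j) (s : C →* C)
    (h1 : ∀ c, ∃ d, c * s c = j d) (h2 : ∀ d, s (j d) = j d) (f : C) (hf : s f = f)
    (hfR : f ∉ j.range) (hf2 : f ^ 2 ∈ j.range)
    (hfix : ∀ c, s c = c → c ∈ j.range ∨ c * f ∈ j.range)
    (ht : ∃ g : C, g ^ 2 = 1 ∧ ∀ x : C, x ^ 2 = 1 → x = 1 ∨ x = g)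
    (heven : 2 ∣ Nat.card D) : ∃ m, Odd m ∧ Nat.card C = m * (2 * Nat.card D) := by
  classical
  set Fix : Subgroup C := s.eqLocus (MonoidHom.id C) with hFix
  have memFix : ∀ c, c ∈ Fix ↔ s c = c := fun c => Iff.rfl
  have hle : j.range ≤ Fix := by rintro _ ⟨d, rfl⟩; exact h2 d
  have hcR : Nat.card j.range = Nat.card D :=
    (Nat.card_congr (MonoidHom.ofInjective hj).toEquiv).symm
  have hrel : j.range.relIndex Fix = 2 := by
    rw [Subgroup.relIndex, Subgroup.index_eq_two_iff]
    refine ⟨⟨f, hf⟩, fun b => ?_⟩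
    rw [Subgroup.mem_subgroupOf, Subgroup.mem_subgroupOf, xor_iff_iff_not]
    constructor
    · intro ha hb
      exact hfR ((Subgroup.mul_mem_cancel_left _ hb).1 ha)
    · intro hb
      exact (hfix b b.2).resolve_left hb
  have hcF : Nat.card Fix = 2 * Nat.card D := by
    rw [← hcR, ← hrel, mul_comm]
    rw [← Nat.card_congr (Subgroup.subgroupOfEquivOfLe hle).toEquiv]
    exact (Subgroup.card_mul_index _).symm
  obtain ⟨g, hg, hgall⟩ := ht
  haveI : Fact (Nat.Prime 2) := ⟨Nat.prime_two⟩
  obtain ⟨t, ht⟩ := exists_prime_orderOf_dvd_card' 2 heven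
  have hgt : g = j t := by
    have h3 : j t ^ 2 = 1 := by rw [← map_pow, ← ht, pow_orderOf_eq_one, map_one]
    rcases hgall _ h3 with h4 | h4
    · exfalso
      have : t = 1 := hj (by rw [h4, map_one])
      rw [this, orderOf_one] at ht
      omega
    · exact h4.symm
  have hgR : g ∈ j.range := ⟨t, hgt.symm⟩
  have hsq : ∀ x ∈ j.range, ∃ y ∈ Fix, y ^ 2 = x := by
    set sq : Fix →* C := (powMonoidHom 2 : C →* C).comp Fix.subtype with hsqd
    have hr : sq.range ≤ j.range := by
      rintro _ ⟨⟨y, hy⟩, rfl⟩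
      change y ^ 2 ∈ j.range
      rcases hfix y hy with h | h
      · exact pow_mem h 2
      · have := pow_mem h 2
        rw [mul_pow] at this
        exact (Subgroup.mul_mem_cancel_right _ hf2).1 this
    have hk : Nat.card sq.ker ≤ 2 := by
      have : Function.Injective (fun x : sq.ker => decide (((x : Fix) : C) = 1)) := by
        intro x y hxy
        have hx := hgall ((x : Fix) : C) x.2
        have hy := hgall ((y : Fix) : C) y.2
        simp only [decide_eq_decide] at hxy
        apply Subtype.ext; apply Subtype.ext
        by_cases h : ((x : Fix) : C) = 1
        · rw [h, hxy.1 h]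
        · rw [hx.resolve_left h, hy.resolve_left (fun h' => h (hxy.2 h'))]
      have := Nat.card_le_card_of_injective _ this
      simpa using this
    have hcard : Nat.card sq.ker * Nat.card sq.range = Nat.card Fix := by
      rw [← Subgroup.index_ker]; exact Subgroup.card_mul_index _
    have heq : sq.range = j.range := by
      apply Subgroup.eq_of_le_of_card_ge hr
      rw [hcF] at hcard
      rw [hcR]
      nlinarith
    intro x hx
    rw [← heq] at hx
    obtain ⟨y, hy⟩ := hx
    exact ⟨y, y.2, hy⟩
  have hodd : Odd Fix.index := by
    rw [Subgroup.index]
    apply odd_card_of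
    intro x
    induction x using QuotientGroup.induction_on with
    | H y =>
    intro hy
    rw [← QuotientGroup.mk_pow, QuotientGroup.eq_one_iff] at hy
    rw [QuotientGroup.eq_one_iff]
    by_contra hyF
    have hy2 : s y ^ 2 = y ^ 2 := by rw [← map_pow]; exact hy
    have hz : (y⁻¹ * s y) ^ 2 = 1 := by
      rw [mul_pow, hy2, inv_pow, inv_mul_cancel]
    have hz1 : y⁻¹ * s y ≠ 1 := by
      intro h
      exact hyF (by rw [memFix]; exact (inv_mul_eq_one.1 h).symm)
    have hzg := (hgall _ hz).resolve_left hz1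
    have hsy : s y = y * g := by rw [← hzg]; group
    obtain ⟨d, hd⟩ := h1 y
    have hyR : y ^ 2 ∈ j.range := by
      have : y ^ 2 * g ∈ j.range := ⟨d, by rw [← hd, hsy, sq, mul_assoc]⟩
      exact (Subgroup.mul_mem_cancel_right _ hgR).1 this
    obtain ⟨w, hw, hwy⟩ := hsq _ hyR
    have h5 : (y * w⁻¹) ^ 2 = 1 := by rw [mul_pow, inv_pow, hwy, mul_inv_cancel]
    have h6 : y * w⁻¹ ∈ Fix := by
      rcases hgall _ h5 with h | h <;> rw [h]
      · exact one_mem _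
      · exact hle hgR
    exact hyF ((Subgroup.mul_mem_cancel_right _ (inv_mem hw)).1 h6)
  refine ⟨Fix.index, hodd, ?_⟩
  rw [← hcF, Subgroup.index_mul_card]

end TwoCl

set_option linter.unusedSectionVars false
set_option linter.style.haveILetI false
set_option linter.unusedVariables false

open IntermediateField NumberField

namespace TwoCl
section
variable {p q : ℕ}

/-- abbreviation -/
noncomputable abbrev iK (h : PQ p q) (n : ℕ) : 𝓞 (F n) →+* 𝓞 (K (p * q) n) :=
  incl (stepK h.pos n).le
/-- abbreviation -/
noncomputable abbrev sK (h : PQ p q) (n : ℕ) : 𝓞 (K (p * q) n) ≃+* 𝓞 (K (p * q) n) :=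
  (stepK h.pos n).σ
/-- abbreviation -/
noncomputable abbrev iT (h : PQ p q) (n : ℕ) : 𝓞 (K (p * q) n) →+* 𝓞 (K (p * q) (n + 1)) :=
  incl (stepKK h.pos n).le
/-- abbreviation -/
noncomputable abbrev sT (h : PQ p q) (n : ℕ) :
    𝓞 (K (p * q) (n + 1)) ≃+* 𝓞 (K (p * q) (n + 1)) :=
  (stepKK h.pos n).σ

theorem qK (h : PQ p q) (n : ℕ) : QD (iK h n) (sK h n) := qdK h.pos n

theorem qT (h : PQ p q) (n : ℕ) : QD (iT h n) (sT h n) := qdKK h.pos n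

theorem omega_facts (h : PQ p q) (n : ℕ) : ∃ w : 𝓞 (K (p * q) n), v w = (1 + sd (p * q)) / 2 ∧
    w + sK h n w = 1 ∧ ∃ y, w * sK h n w = 2 * y := by
  obtain ⟨w, hw⟩ := exists_omega h.mod8 n
  have hs : v (sK h n w) = (1 - sd (p * q)) / 2 := by
    rw [(stepK h.pos n).v_σ (a := 1 / 2) (b := 1 / 2)
      (div_mem (one_mem _) (_root_.natCast_mem _ 2)) (div_mem (one_mem _) (_root_.natCast_mem _ 2))
      (by rw [hw]; ring)]
    ring
  refine ⟨w, hw, ?_, ((p * q + 1) / 8 : ℕ), ?_⟩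
  · apply v_inj
    rw [map_add, hw, hs, map_one]; ring
  · apply v_inj
    have h8 : (8 : ℂ) * (((p * q + 1) / 8 : ℕ) : ℂ) = (p * q : ℕ) + 1 := by
      have h1 := h.mod8
      have : 8 * ((p * q + 1) / 8) = p * q + 1 := by omega
      exact_mod_cast this
    rw [map_mul, map_mul, hw, hs, map_ofNat, map_natCast]
    linear_combination (-1/4) * sd_sq (p * q) - (1/4) * h8

theorem omega_mem (h : PQ p q) (n : ℕ) {w : 𝓞 (K (p * q) n)} (h1 : w + sK h n w = 1)
    (h2 : ∃ y, w * sK h n w = 2 * y) {P : Ideal (𝓞 (K (p * q) n))} (hP : P.IsPrime)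
    (h2P : (2 : 𝓞 (K (p * q) n)) ∈ P) : (w ∈ P ∧ sK h n w ∉ P) ∨ (w ∉ P ∧ sK h n w ∈ P) := by
  obtain ⟨y, hy⟩ := h2
  have hm : w * sK h n w ∈ P := by rw [hy]; exact P.mul_mem_right _ h2P
  have hn : ¬ (w ∈ P ∧ sK h n w ∈ P) := by
    rintro ⟨ha, hb⟩
    apply hP.ne_top
    rw [Ideal.eq_top_iff_one, ← h1]
    exact add_mem ha hb
  have := hP.mem_or_mem hm
  tauto

theorem split (h : PQ p q) (n : ℕ) {π : 𝓞 (F n)} (hπ : Prime π) (hπ2 : π ∣ 2)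
    {P : Ideal (𝓞 (K (p * q) n))} (hP : P.IsPrime) (hm : iK h n π ∈ P) :
    P.map (sK h n) ≠ P ∧ P * P.map (sK h n) = Ideal.span {iK h n π} := by
  have Q := qK h n
  have h0 := Q.ne_bot_of_mem hπ.ne_zero hm
  have h2P : (2 : 𝓞 (K (p * q) n)) ∈ P := by
    obtain ⟨y, hy⟩ := hπ2
    have : (2 : 𝓞 (K (p * q) n)) = iK h n π * iK h n y := by rw [← map_mul, ← hy, map_ofNat]
    rw [this]; exact P.mul_mem_right _ hm
  obtain ⟨w, -, h1, h2⟩ := omega_facts h n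
  have hne : P.map (sK h n) ≠ P := by
    intro e
    have hiff : sK h n w ∈ P ↔ w ∈ P := by rw [← Q.mem_map_s, e]
    have := omega_mem h n h1 h2 hP h2P
    tauto
  refine ⟨hne, ?_⟩
  rcases Q.trichotomy hP h0 with ⟨_, h3⟩ | ⟨h3, _⟩ | h3
  · rw [h3, Q.comap_eq hπ hP hm]
  · exact absurd h3 hne
  · exact absurd h3.2.2.1 hne

theorem split_uniq (h : PQ p q) (n : ℕ) {π : 𝓞 (F n)} (hπ : Prime π) (hπ2 : π ∣ 2)
    {P P' : Ideal (𝓞 (K (p * q) n))} (hP : P.IsPrime) (hm : iK h n π ∈ P)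
    (hP' : P'.IsPrime) (hm' : iK h n π ∈ P') : P' = P ∨ P' = P.map (sK h n) := by
  have Q := qK h n
  have h0 := Q.ne_bot_of_mem hπ.ne_zero hm
  have h1 := (split h n hπ hπ2 hP hm).2
  have hle : P * P.map (sK h n) ≤ P' := by
    rw [h1, Ideal.span_singleton_le_iff_mem]; exact hm'
  rcases (hP'.mul_le).1 hle with h2 | h2
  · exact Or.inl ((hP.isMaximal h0).eq_of_le hP'.ne_top h2).symm
  · exact Or.inr (((Ideal.map_isPrime_of_equiv (sK h n)).isMaximal (Q.map_s_ne_bot h0)).eq_of_le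
      hP'.ne_top h2).symm

theorem two_add_dvd (n : ℕ) : (2 + c n) ∣ 2 := by
  rw [← Ideal.mem_span_singleton]
  have := Ideal.absNorm_mem (Ideal.span {2 + c n})
  rw [(absNorm_two_pm n).1] at this
  exact_mod_cast this

theorem c_sq_K (h : PQ p q) (n : ℕ) :
    iK h (n + 1) (c (n + 1)) ^ 2 = iT h n (iK h n (2 + c n)) := by
  apply v_inj
  rw [map_pow, v_incl, v_c, cc_succ, v_incl, v_incl, map_add, v_c, map_ofNat]

theorem sT_c (h : PQ p q) (n : ℕ) :
    sT h n (iK h (n + 1) (c (n + 1))) = - iK h (n + 1) (c (n + 1)) :=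
  (stepKK h.pos n).σ_s (by rw [v_incl, v_c])

/-- all the data about the prime above two -/
structure Data (h : PQ p q) (n : ℕ) (P : Ideal (𝓞 (K (p * q) (n + 1))))
    (P0 : Ideal (𝓞 (K (p * q) n))) : Prop where
  ram : (qT h n).Ram P
  sq : P ^ 2 = P0.map (iT h n)
  mem : iK h (n + 1) (c (n + 1)) ∈ P
  mul : P * P.map (sK h (n + 1)) = Ideal.span {iK h (n + 1) (c (n + 1))}
  prime0 : Prime P0
  prime1 : Prime (P0.map (sK h n))
  ne : P0.map (sK h n) ≠ P0
  mul0 : P0 * P0.map (sK h n) = Ideal.span {iK h n (2 + c n)}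

theorem exists_data (h : PQ p q) (n : ℕ) : ∃ P P0, Data h n P P0 := by
  have Q := qK h (n + 1)
  have T := qT h n
  obtain ⟨P, hP, hm⟩ := exists_prime_mem (Q.not_unit (prime_c n))
  have h0 := Q.ne_bot_of_mem (prime_c n).ne_zero hm
  obtain ⟨hne, hmul⟩ := split h (n + 1) (prime_c n) (c_dvd_two n) hP hm
  have h2P : (2 : 𝓞 (K (p * q) (n + 1))) ∈ P := by
    obtain ⟨y, hy⟩ := c_dvd_two n
    have : (2 : 𝓞 (K (p * q) (n + 1))) = iK h (n + 1) (c (n + 1)) * iK h (n + 1) y := by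
      rw [← map_mul, ← hy, map_ofNat]
    rw [this]; exact P.mul_mem_right _ hm
  have hTP : (P.map (sT h n)).IsPrime := Ideal.map_isPrime_of_equiv _
  obtain ⟨w, hw, h1, h2⟩ := omega_facts h (n + 1)
  have hTw : sT h n w = w := by
    obtain ⟨w0, hw0⟩ := exists_omega h.mod8 n
    have : w = iT h n w0 := v_inj (by rw [v_incl, hw, hw0])
    rw [this, T.fix]
  have hτ : P.map (sT h n) = P := by
    rcases split_uniq h (n + 1) (prime_c n) (c_dvd_two n) hP hm hTP (by
      rw [T.mem_map_s, sT_c]; exact neg_mem hm) with e | e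
    · exact e
    · exfalso
      have hiff : w ∈ P ↔ sK h (n + 1) w ∈ P := by
        rw [← Q.mem_map_s, ← e, T.mem_map_s, hTw]
      have := omega_mem h (n + 1) h1 h2 hP h2P
      tauto
  have hnorm : P.absNorm = 2 := by
    have e1 := congrArg Ideal.absNorm hmul
    rw [map_mul, Q.absNorm_map_s] at e1
    have e2 := Q.norm (Ideal.span {c (n + 1)})
    rw [Ideal.map_span, Set.image_singleton, absNorm_c] at e2
    rw [e2, ← sq] at e1
    exact Nat.pow_left_injective (n := 2) (by norm_num) e1
  have hram : T.Ram P := by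
    rcases T.trichotomy hP h0 with ⟨h3, _⟩ | ⟨_, h3⟩ | h3
    · exact absurd hτ h3
    · exfalso
      have e := T.norm (P.comap (iT h n))
      rw [← h3, hnorm] at e
      have : (P.comap (iT h n)).absNorm < 2 := by nlinarith
      interval_cases (P.comap (iT h n)).absNorm <;> omega
    · exact h3
  have hP0 : (P.comap (iT h n)).IsPrime := hP.comap _
  have h00 := T.comap_ne_bot h0
  have hm0 : iK h n (2 + c n) ∈ P.comap (iT h n) := by
    rw [Ideal.mem_comap, ← c_sq_K, sq]; exact P.mul_mem_left _ hm
  obtain ⟨hne0, hmul0⟩ := split h n (prime_two_add n) (two_add_dvd n) hP0 hm0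
  exact ⟨P, P.comap (iT h n), hram, hram.2.2.2.1, hm, hmul, Ideal.prime_of_isPrime h00 hP0,
    Ideal.prime_of_isPrime ((qK h n).map_s_ne_bot h00) (Ideal.map_isPrime_of_equiv _), hne0, hmul0⟩

theorem lemmaW (h : PQ p q) (n : ℕ) {α : 𝓞 (K (p * q) (n + 1))} (hα : α ≠ 0)
    (hτ : (Ideal.span {α}).map (sT h n) = Ideal.span {α}) :
    ∃ b : 𝓞 (K (p * q) n), b ≠ 0 ∧ (Ideal.span {α} = Ideal.span {iT h n b} ∨
      Ideal.span {α} * Ideal.span {iK h (n + 1) (c (n + 1))} = Ideal.span {iT h n b}) := by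
  have Q := qK h (n + 1)
  have T := qT h n
  rw [Ideal.map_span, Set.image_singleton, eq_comm, Ideal.span_singleton_eq_span_singleton] at hτ
  obtain ⟨u, hu⟩ := hτ
  obtain ⟨η, hη⟩ := unit_eq h (n + 1) u
  have huu : (u : 𝓞 (K (p * q) (n + 1))) * sT h n u = 1 := by
    have e := congrArg (sT h n) hu
    rw [map_mul, T.inv, ← hu] at e
    apply mul_left_cancel₀ hα
    linear_combination e
  have hηη : (η : 𝓞 (F (n + 1))) * sF n η = 1 := by
    apply Q.inj
    have e := tau_F h.pos n (η : 𝓞 (F (n + 1)))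
    rw [map_mul, ← e, map_one]
    rw [hη] at huu
    exact huu
  obtain ⟨w, e, he, hw⟩ := corUF n (web n).odd η hηη
  have hw' : (u : 𝓞 (K (p * q) (n + 1))) * sT h n (iK h (n + 1) w) = iK h (n + 1) e * iK h (n + 1) w := by
    rw [hη, ← map_mul, ← hw, map_mul]
    congr 1
    exact tau_F h.pos n (w : 𝓞 (F (n + 1)))
  set W := iK h (n + 1) (w : 𝓞 (F (n + 1))) with hW
  have hWu : IsUnit W := (w.isUnit).map (iK h (n + 1))
  have hspan : Ideal.span {α} = Ideal.span {α * W} := by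
    obtain ⟨x, hx⟩ := hWu
    rw [Ideal.span_singleton_eq_span_singleton]
    exact ⟨x, by rw [hx]⟩
  have hαW : α * W ≠ 0 := mul_ne_zero hα hWu.ne_zero
  have hc0 : iK h (n + 1) (c (n + 1)) ≠ 0 := by
    rw [Ne, map_eq_zero_iff _ Q.inj]; exact (prime_c n).ne_zero
  have hτα : sT h n (α * W) = α * W * iK h (n + 1) e := by
    rw [map_mul, ← hu]; linear_combination α * hw'
  rcases he with rfl | rfl
  · obtain ⟨b, hb⟩ := T.mem (α * W) (by rw [hτα]; simp)
    refine ⟨b, ?_, Or.inl (by rw [hspan, hb])⟩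
    rintro rfl
    exact hαW (by rw [← hb, map_zero])
  · obtain ⟨b, hb⟩ := T.mem (α * W * iK h (n + 1) (c (n + 1))) (by
      rw [map_mul, hτα, sT_c]; simp)
    refine ⟨b, ?_, Or.inr (by rw [hspan, hb, Ideal.span_singleton_mul_span_singleton])⟩
    rintro rfl
    exact mul_ne_zero hαW hc0 (by rw [← hb, map_zero])

theorem not_dvd_primes {R : Type*} [CommRing R] [IsDedekindDomain R] {I J : Ideal R} (hI : Prime I)
    (hJ : Prime J) (hne : I ≠ J) : ¬ I ∣ J := by
  intro hd
  apply hne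
  have h1 := Ideal.le_of_dvd hd
  exact (((Ideal.isPrime_of_prime hJ).isMaximal hJ.ne_zero).eq_of_le
    (Ideal.isPrime_of_prime hI).ne_top h1).symm

theorem span_c_sq (h : PQ p q) (n : ℕ) : Ideal.span {iK h (n + 1) (c (n + 1))} ^ 2 =
    (Ideal.span {iK h n (2 + c n)}).map (iT h n) := by
  rw [Ideal.span_singleton_pow, c_sq_K, Ideal.map_span, Set.image_singleton]

theorem j_inj (h : PQ p q) (n : ℕ) : Function.Injective (clMap (iT h n) (qT h n).inj) := by
  have T := qT h n
  rw [injective_iff_map_eq_one]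
  intro x hx
  obtain ⟨J, hJ, rfl⟩ := cl_surj x
  rw [clMap_cl, cl_eq_one_iff] at hx
  obtain ⟨α, hα, e⟩ := hx
  obtain ⟨P, P0, H⟩ := exists_data h n
  obtain ⟨b, hb, hb' | hb'⟩ := lemmaW h n hα (by rw [← e, T.map_i_s])
  · rw [cl_eq_one_iff]
    refine ⟨b, hb, T.map_i_injective hJ ?_⟩
    rw [e, hb', Ideal.map_span, Set.image_singleton]
  · exfalso
    have e1 : J ^ 2 * Ideal.span {iK h n (2 + c n)} = Ideal.span {b} ^ 2 := by
      have hne : Ideal.span {iK h n (2 + c n)} ≠ ⊥ := by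
        rw [← H.mul0]; exact mul_ne_zero H.prime0.ne_zero H.prime1.ne_zero
      apply T.map_i_injective (mul_ne_zero (pow_ne_zero 2 hJ) hne)
      rw [Ideal.map_mul, Ideal.map_pow, Ideal.map_pow, ← span_c_sq, ← mul_pow, e, hb',
        Ideal.map_span, Set.image_singleton]
    rw [← H.mul0] at e1
    refine parity (u := P0.map (sK h n)) (v := 1) (x := J) (y := Ideal.span {b}) H.prime0 ?_ ?_ hJ ?_
    · exact not_dvd_primes H.prime0 H.prime1 H.ne.symm
    · exact fun hd => H.prime0.not_isUnit (isUnit_of_dvd_one hd)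
    · rw [one_mul, ← e1]; ring

theorem P_notMem (h : PQ p q) (n : ℕ) {P P0} (H : Data h n P P0) :
    cl P H.ram.2.1 ∉ (clMap (iT h n) (qT h n).inj).range := by
  have T := qT h n
  intro hmem
  obtain ⟨x, hx⟩ := inv_mem hmem
  obtain ⟨J, hJ, rfl⟩ := cl_surj x
  rw [eq_inv_iff_mul_eq_one, clMap_cl, ← cl_mul, cl_eq_one_iff] at hx
  obtain ⟨α, hα, e⟩ := hx
  obtain ⟨b, hb, hb' | hb'⟩ := lemmaW h n hα (by
    rw [← e, Ideal.map_mul, T.map_i_s, H.ram.2.2.1])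
  · have e1 : J ^ 2 * P0 = Ideal.span {b} ^ 2 := by
      apply T.map_i_injective (mul_ne_zero (pow_ne_zero 2 hJ) H.prime0.ne_zero)
      rw [Ideal.map_mul, Ideal.map_pow, Ideal.map_pow, ← H.sq, ← mul_pow, e, hb',
        Ideal.map_span, Set.image_singleton]
    refine parity (u := 1) (v := 1) (x := J) (y := Ideal.span {b}) H.prime0 ?_ ?_ hJ ?_
    · exact fun hd => H.prime0.not_isUnit (isUnit_of_dvd_one hd)
    · exact fun hd => H.prime0.not_isUnit (isUnit_of_dvd_one hd)
    · rw [one_mul, ← e1]; ring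
  · have hne : Ideal.span {iK h n (2 + c n)} ≠ ⊥ := by
      rw [← H.mul0]; exact mul_ne_zero H.prime0.ne_zero H.prime1.ne_zero
    have e1 : J ^ 2 * P0 * Ideal.span {iK h n (2 + c n)} = Ideal.span {b} ^ 2 := by
      apply T.map_i_injective (mul_ne_zero (mul_ne_zero (pow_ne_zero 2 hJ) H.prime0.ne_zero) hne)
      rw [Ideal.map_mul, Ideal.map_mul, Ideal.map_pow, Ideal.map_pow, ← H.sq, ← span_c_sq,
        ← mul_pow, ← mul_pow, e, hb', Ideal.map_span, Set.image_singleton]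
    rw [← H.mul0] at e1
    refine parity (u := 1) (v := 1) (x := J * P0) (y := Ideal.span {b}) H.prime1 ?_ ?_
      (mul_ne_zero hJ H.prime0.ne_zero) ?_
    · exact fun hd => H.prime1.not_isUnit (isUnit_of_dvd_one hd)
    · exact fun hd => H.prime1.not_isUnit (isUnit_of_dvd_one hd)
    · rw [one_mul, ← e1]; ring

theorem unit_hU' (h : PQ p q) (n : ℕ) (ε : (𝓞 (K (p * q) n))ˣ) :
    ∃ u : (𝓞 (K (p * q) (n + 1)))ˣ, u * sT h n u = iT h n (ε : 𝓞 (K (p * q) n)) := by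
  obtain ⟨e, he⟩ := unit_eq h n ε
  obtain ⟨w, hw⟩ := unit_norm (web n) e
  refine ⟨Units.map (iK h (n + 1) : _ →* _) w, ?_⟩
  have h1 : ((Units.map (iK h (n + 1) : _ →* _) w : (𝓞 (K (p * q) (n + 1)))ˣ) :
    𝓞 (K (p * q) (n + 1))) = iK h (n + 1) w := rfl
  have h2 := congrArg Units.val hw
  have h3 : (w : 𝓞 (F (n + 1))) * sF n w = iF n e := h2
  have h4 := tau_F h.pos n (w : 𝓞 (F (n + 1)))
  rw [h1, he]
  have h5 : sT h n (iK h (n + 1) (w : 𝓞 (F (n + 1)))) = iK h (n + 1) (sF n w) := h4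
  rw [h5, ← map_mul, h3]
  exact v_inj rfl

theorem fix_form (h : PQ p q) (n : ℕ) {P P0} (H : Data h n P P0)
    (x : ClassGroup (𝓞 (K (p * q) (n + 1)))) (hx : sCl (sT h n) x = x) :
    x ∈ (clMap (iT h n) (qT h n).inj).range ∨
      x * cl P H.ram.2.1 ∈ (clMap (iT h n) (qT h n).inj).range := by
  have T := qT h n
  have Q := qK h (n + 1)
  set R := (clMap (iT h n) (qT h n).inj).range with hR
  set f := cl P H.ram.2.1 with hf
  have hf2 : f * f ∈ R := by
    have h00 : P0 ≠ ⊥ := H.prime0.ne_zero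
    refine ⟨cl P0 h00, ?_⟩
    rw [clMap_cl, ← cl_mul]
    exact cl_congr _ (by rw [← H.sq, sq])
  have hst := T.fixed_mem_strong (fun ε _ => unit_hU' h n ε) hx
  have hle : Subgroup.closure {c | ∃ (P : Ideal (𝓞 (K (p * q) (n + 1)))) (hP : T.Ram P),
      c = cl P hP.2.1} ≤ Subgroup.zpowers f := by
    rw [Subgroup.closure_le]
    rintro _ ⟨P', hP', rfl⟩
    have h1 := hP'.2.2.2.2 (iK h (n + 1) (c (n + 1)))
    rw [sT_c] at h1
    have h2 : 2 * iK h (n + 1) (c (n + 1)) ∈ P' := by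
      have := neg_mem h1
      convert this using 1; ring
    have h3 : iK h (n + 1) (c (n + 1)) ∈ P' := by
      rcases hP'.1.mem_or_mem h2 with h | h
      · exact c_mem_of_two_mem (n + 1) (iK _ (n + 1)) hP'.1 h
      · exact h
    rcases split_uniq h (n + 1) (prime_c n) (c_dvd_two n) H.ram.1 H.mem hP'.1 h3 with e | e
    · rw [cl_congr hP'.2.1 e]
      exact Subgroup.mem_zpowers _
    · have h4 : cl P' hP'.2.1 * f = 1 := by
        rw [hf, ← cl_mul, cl_eq_one_iff]
        refine ⟨iK h (n + 1) (c (n + 1)), ?_, ?_⟩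
        · rw [Ne, map_eq_zero_iff _ Q.inj]; exact (prime_c n).ne_zero
        · rw [e, ← H.mul]; exact mul_comm _ _
      rw [eq_inv_of_mul_eq_one_left h4]
      exact inv_mem (Subgroup.mem_zpowers _)
  obtain ⟨y, hy, z, hz, rfl⟩ := Subgroup.mem_sup.1 hst
  obtain ⟨k, rfl⟩ := Subgroup.mem_zpowers_iff.1 (hle hz)
  have hy' : y ∈ R := hy
  rcases Int.even_or_odd' k with ⟨m, rfl | rfl⟩
  · left
    rw [zpow_mul, zpow_ofNat, sq]
    exact mul_mem hy' (zpow_mem hf2 m)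
  · right
    have : y * f ^ (2 * m + 1) * f = y * (f * f) ^ (m + 1) := by
      rw [mul_assoc, ← zpow_add_one, ← sq, ← zpow_natCast, ← zpow_mul]
      congr 2; push_cast; ring
    rw [this]
    exact mul_mem hy' (zpow_mem hf2 _)

theorem growth (h : PQ p q) (n : ℕ) (heven : 2 ∣ Nat.card (ClassGroup (𝓞 (K (p * q) n)))) :
    ∃ m, Odd m ∧ Nat.card (ClassGroup (𝓞 (K (p * q) (n + 1)))) =
      m * (2 * Nat.card (ClassGroup (𝓞 (K (p * q) n)))) := by
  obtain ⟨P, P0, H⟩ := exists_data h n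
  have T := qT h n
  refine group_lemma (clMap (iT h n) T.inj) (j_inj h n) (sCl (sT h n)) T.cl_mul_s T.s_j
    (cl P H.ram.2.1) ?_ (P_notMem h n H) ?_ (fix_form h n H) (two_tors h (n + 1)) heven
  · rw [sCl_cl]; exact cl_congr _ H.ram.2.2.1
  · have h00 : P0 ≠ ⊥ := H.prime0.ne_zero
    refine ⟨cl P0 h00, ?_⟩
    rw [clMap_cl, sq, ← cl_mul]
    exact cl_congr _ (by rw [← H.sq, sq])

end
end TwoCl

set_option linter.unusedSectionVars false
set_option linter.style.haveILetI false
set_option linter.unusedVariables false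

open IntermediateField NumberField

namespace TwoCl
section
variable {p q : ℕ}

theorem even_zero (h : PQ p q) : 2 ∣ Nat.card (ClassGroup (𝓞 (K (p * q) 0))) := by
  have Q := qK h 0
  obtain ⟨P, hP, hP2⟩ := exists_ram_p h 0
  have hP0 : P ≠ ⊥ := hP.2.1
  have hp0 : iK h 0 (p : 𝓞 (F 0)) ≠ 0 := by
    rw [Ne, map_eq_zero_iff _ Q.inj]; exact (h.prime_p 0).ne_zero
  have hsq : cl P hP0 ^ 2 = 1 := by
    rw [sq, ← cl_mul, cl_eq_one_iff]
    exact ⟨_, hp0, by rw [← sq]; exact hP2⟩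
  by_cases h1 : cl P hP0 = 1
  · exfalso
    rw [cl_eq_one_iff] at h1
    obtain ⟨α, hα, e⟩ := h1
    rw [e, Ideal.span_singleton_pow, Ideal.span_singleton_eq_span_singleton] at hP2
    obtain ⟨u, hu⟩ := hP2
    obtain ⟨ε, hε⟩ := unit_eq h 0 u
    have hα2 : ∃ t : 𝓞 (F 0), (t = 1 ∨ t = -1) ∧ iK h 0 (p * t) = α ^ 2 := by
      rcases unit_F0 ε with rfl | rfl
      · refine ⟨1, Or.inl rfl, ?_⟩
        rw [hε] at hu
        rw [map_mul, ← hu]; simp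
      · refine ⟨-1, Or.inr rfl, ?_⟩
        rw [hε] at hu
        rw [map_mul]
        change _ = iK h 0 p at hu
        rw [← hu]; simp
    obtain ⟨t, ht, hα2⟩ := hα2
    have htt : t * t = 1 := by rcases ht with rfl | rfl <;> ring
    have hs2 : (sK h 0 α) ^ 2 = α ^ 2 := by rw [← map_pow, ← hα2, Q.fix]
    rcases sq_eq_sq_iff_eq_or_eq_neg.1 hs2 with hs | hs
    · obtain ⟨a, rfl⟩ := Q.mem _ hs
      rw [← map_pow] at hα2
      have h3 := Q.inj hα2
      refine parity (u := t) (v := 1) (x := 1) (y := a) (h.prime_p 0) ?_ ?_ one_ne_zero ?_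
      · intro hd; exact (h.prime_p 0).not_isUnit (isUnit_of_dvd_one (hd.trans ⟨t, htt.symm⟩))
      · intro hd; exact (h.prime_p 0).not_isUnit (isUnit_of_dvd_one hd)
      · rw [h3]; ring
    · obtain ⟨D, hD⟩ := exists_sd (p * q) 0
      have hσD : sK h 0 D = - D := (stepK h.pos 0).σ_s hD
      obtain ⟨b, hb⟩ := Q.mem (α * D) (by rw [map_mul, hs, hσD]; ring)
      have h3 : (p : 𝓞 (F 0)) * t * (-(p * q)) = b ^ 2 := by
        apply Q.inj
        rw [map_pow, hb, mul_pow, D_sq h 0 hD, map_mul, hα2, map_neg, map_mul]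
      refine parity (u := p ^ 2 * (-t)) (v := 1) (x := 1) (y := b) (h.prime_q 0) ?_ ?_ one_ne_zero ?_
      · intro hd
        rcases (h.prime_q 0).dvd_or_dvd hd with hd | hd
        · have := (h.prime_q 0).dvd_of_dvd_pow hd
          have h4 := map_dvd eqZ this
          rw [map_natCast, map_natCast] at h4
          have h5 : q ∣ p := by exact_mod_cast h4
          exact h.ne ((Nat.prime_dvd_prime_iff_eq h.hq h.hp).1 h5).symm
        · exact (h.prime_q 0).not_isUnit (isUnit_of_dvd_one (hd.trans ⟨-t, by rw [neg_mul_neg, htt]⟩))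
      · intro hd; exact (h.prime_q 0).not_isUnit (isUnit_of_dvd_one hd)
      · rw [one_mul, ← h3]; ring
  · rw [← orderOf_eq_prime hsq h1]
    exact orderOf_dvd_natCard _

theorem card_K (h : PQ p q) (n : ℕ) : ∃ m, Odd m ∧ Nat.card (ClassGroup (𝓞 (K (p * q) n))) =
    m * (2 ^ n * Nat.card (ClassGroup (𝓞 (K (p * q) 0)))) := by
  induction n with
  | zero => exact ⟨1, odd_one, by simp⟩
  | succ n ih =>
    obtain ⟨m, hm, e⟩ := ih
    obtain ⟨m', hm', e'⟩ := growth h n (by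
      rw [e]; exact ((even_zero h).mul_left _).mul_left _)
    exact ⟨m' * m, hm'.mul hm, by rw [e', e]; ring⟩
end

section
variable {G : Type*} [CommGroup G] [Finite G]

theorem mem_prim {x : G} : x ∈ CommGroup.primaryComponent G 2 ↔ ∃ k : ℕ, x ^ 2 ^ k = 1 := by
  constructor
  · rintro ⟨k, hk⟩
    exact ⟨k, hk⟩
  · rintro ⟨k, hk⟩
    exact ⟨k, hk⟩

theorem prim_card : ∃ a m : ℕ, Odd m ∧ Nat.card (CommGroup.primaryComponent G 2) = 2 ^ a ∧
    Nat.card G = m * 2 ^ a := by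
  obtain ⟨a, ha⟩ := (IsPGroup.iff_card (p := 2) (G := CommGroup.primaryComponent G 2)).1 (by
    rintro ⟨x, hx⟩
    obtain ⟨k, hk⟩ := mem_prim.1 hx
    exact ⟨k, Subtype.ext hk⟩)
  refine ⟨a, Nat.card (G ⧸ CommGroup.primaryComponent G 2), ?_, ha, ?_⟩
  · rw [← Nat.not_even_iff_odd, even_iff_two_dvd]
    intro hd
    obtain ⟨x, hx⟩ := exists_prime_orderOf_dvd_card' 2 hd
    obtain ⟨y, rfl⟩ := QuotientGroup.mk_surjective x
    have h2 := pow_orderOf_eq_one (y : G ⧸ CommGroup.primaryComponent G 2)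
    rw [hx, ← QuotientGroup.mk_pow, QuotientGroup.eq_one_iff, mem_prim] at h2
    obtain ⟨k, hk⟩ := h2
    have : y ∈ CommGroup.primaryComponent G 2 := mem_prim.2 ⟨k + 1, by
      rw [pow_succ', pow_mul, hk]⟩
    rw [(QuotientGroup.eq_one_iff y).2 this, orderOf_one] at hx
    omega
  · rw [← ha]; exact Subgroup.card_eq_card_quotient_mul_card_subgroup _

theorem prim_cyc (hG : ∃ g : G, g ^ 2 = 1 ∧ ∀ x : G, x ^ 2 = 1 → x = 1 ∨ x = g) :
    IsCyclic (CommGroup.primaryComponent G 2) := by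
  classical
  obtain ⟨g, -, hg⟩ := hG
  obtain ⟨a, m, hm, ha, -⟩ := prim_card (G := G)
  set A := CommGroup.primaryComponent G 2
  haveI : Fintype A := Fintype.ofFinite _
  have hA : ∀ b : A, Finset.card {x : A | x ^ 2 = b} ≤ 2 := by
    intro b
    by_cases hb : ∃ y : A, y ^ 2 = b
    · obtain ⟨y, rfl⟩ := hb
      have : ∀ x ∈ (Finset.univ.filter (fun x : A => x ^ 2 = y ^ 2)),
          (x : G) ∈ ({(y : G), g * y} : Finset G) := by
        intro x hx
        rw [Finset.mem_filter] at hx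
        have h1 : ((x : G) * (y : G)⁻¹) ^ 2 = 1 := by
          have := congrArg (Subtype.val) hx.2
          rw [mul_pow, inv_pow, mul_inv_eq_one]; exact this
        rw [Finset.mem_insert, Finset.mem_singleton]
        rcases hg _ h1 with h | h
        · left; exact mul_inv_eq_one.1 h
        · right; exact mul_inv_eq_iff_eq_mul.1 h
      exact (Finset.card_le_card_of_injOn _ this (Subtype.val_injective.injOn)).trans
        Finset.card_le_two
    · have : Finset.univ.filter (fun x : A => x ^ 2 = b) = ∅ := by
        rw [Finset.filter_eq_empty_iff]
        intro x _ hx; exact hb ⟨x, hx⟩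
      rw [this]; simp
  have hk : ∀ k : ℕ, Finset.card {x : A | x ^ 2 ^ k = 1} ≤ 2 ^ k := by
    intro k
    induction k with
    | zero =>
      rw [pow_zero, Finset.card_le_one]
      intro x hx y hy
      simp only [Finset.mem_filter, Finset.mem_univ, true_and, pow_one] at hx hy
      rw [hx, hy]
    | succ k ih =>
      have := Finset.card_le_mul_card_image_of_maps_to (f := fun x : A => x ^ 2)
        (s := Finset.univ.filter (fun x : A => x ^ 2 ^ (k + 1) = 1))
        (t := Finset.univ.filter (fun x : A => x ^ 2 ^ k = 1)) (by
          intro x hx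
          simp only [Finset.mem_filter, Finset.mem_univ, true_and] at hx ⊢
          rw [← pow_mul, ← pow_succ']; exact hx) 2 (by
          intro b _
          refine (Finset.card_le_card ?_).trans (hA b)
          intro x hx
          simp only [Finset.mem_filter, Finset.mem_univ, true_and] at hx ⊢
          exact hx.2)
      refine this.trans ?_
      rw [pow_succ']
      exact Nat.mul_le_mul_left _ ih
  apply isCyclic_of_card_pow_eq_one_le
  intro n hn
  obtain ⟨j, -, hj⟩ := (Nat.dvd_prime_pow Nat.prime_two).1 (Nat.gcd_dvd_right n (2 ^ a))
  refine (Finset.card_le_card ?_).trans ((hk j).trans ?_)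
  · intro x hx
    simp only [Finset.mem_filter, Finset.mem_univ, true_and] at hx ⊢
    rw [← hj]
    apply orderOf_dvd_iff_pow_eq_one.1
    apply Nat.dvd_gcd (orderOf_dvd_of_pow_eq_one hx)
    rw [← ha]; exact orderOf_dvd_natCard _
  · rw [← hj]; exact Nat.gcd_le_left _ hn
end

theorem F_eq (n : ℕ) : F n = IntermediateField.adjoin ℚ {cc n} := by
  apply le_antisymm
  · induction n with
    | zero => rw [F_zero]; exact bot_le
    | succ n ih =>
      have h1 : cc (n + 1) ∈ IntermediateField.adjoin ℚ {cc (n + 1)} :=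
        IntermediateField.mem_adjoin_simple_self _ _
      have h2 : F n ≤ IntermediateField.adjoin ℚ {cc (n + 1)} := by
        refine ih.trans ?_
        rw [IntermediateField.adjoin_simple_le_iff]
        have : cc n = cc (n + 1) ^ 2 - (2 : ℕ) := by rw [cc_succ]; push_cast; ring
        rw [this]
        exact sub_mem (pow_mem h1 2) (_root_.natCast_mem _ 2)
      rintro z ⟨a, ha, b, hb, rfl⟩
      exact add_mem (h2 ha) (mul_mem (h2 hb) h1)
  · rw [IntermediateField.adjoin_simple_le_iff]; exact cc_mem n

theorem mem_sqrt (p q : ℕ) (z : ℂ) :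
    z ^ 2 = ((-((p : ℤ) * q) : ℤ) : ℂ) ↔ z = sd (p * q) ∨ z = - sd (p * q) := by
  rw [← sq_eq_sq_iff_eq_or_eq_neg, sd_sq]
  push_cast; rfl

theorem sd_mem (d n : ℕ) : sd d ∈ K d n := s_mem_adj

theorem F_le_K (d n : ℕ) : F n ≤ K d n := le_adj

theorem quad_eq (p q : ℕ) : quadField (-((p : ℤ) * q)) = K (p * q) 0 := by
  apply le_antisymm
  · rw [quadField, IntermediateField.adjoin_le_iff]
    intro z hz
    rcases (mem_sqrt p q z).1 hz with rfl | rfl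
    · exact sd_mem _ _
    · exact neg_mem (sd_mem _ _)
  · rintro z ⟨a, ha, b, hb, rfl⟩
    have h0 : F 0 ≤ quadField (-((p : ℤ) * q)) := by rw [F_zero]; exact bot_le
    refine add_mem (h0 ha) (mul_mem (h0 hb) ?_)
    exact IntermediateField.subset_adjoin _ _ ((mem_sqrt p q _).2 (Or.inl rfl))

theorem Lplus_eq (p q n : ℕ) : LplusField n (-((p : ℤ) * q)) = K (p * q) n := by
  apply le_antisymm
  · rw [LplusField, IntermediateField.adjoin_le_iff]
    rintro z (hz | hz)
    · rw [Set.mem_singleton_iff] at hz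
      rw [hz]
      exact F_le_K _ _ (cc_mem n)
    · rcases (mem_sqrt p q z).1 hz with rfl | rfl
      · exact sd_mem _ _
      · exact neg_mem (sd_mem _ _)
  · rintro z ⟨a, ha, b, hb, rfl⟩
    have h0 : F n ≤ LplusField n (-((p : ℤ) * q)) := by
      rw [F_eq, IntermediateField.adjoin_simple_le_iff]
      exact IntermediateField.subset_adjoin _ _ (Or.inl rfl)
    refine add_mem (h0 ha) (mul_mem (h0 hb) ?_)
    exact IntermediateField.subset_adjoin _ _ (Or.inr ((mem_sqrt p q _).2 (Or.inl rfl)))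

theorem two_pow_odd {a b m m' : ℕ} (hm : Odd m) (hm' : Odd m') (e : m * 2 ^ a = m' * 2 ^ b) :
    a = b := by
  have key : ∀ {m a : ℕ}, Odd m → padicValNat 2 (m * 2 ^ a) = a := by
    intro m a hm
    haveI : Fact (Nat.Prime 2) := ⟨Nat.prime_two⟩
    rw [padicValNat.mul hm.pos.ne' (by positivity), padicValNat.prime_pow,
      padicValNat.eq_zero_of_not_dvd hm.not_two_dvd_nat, zero_add]
  rw [← key (a := a) hm, e, key hm']

theorem card_congr_field {E E' : IntermediateField ℚ ℂ} (h : E = E') :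
    Nat.card (twoClassGroup E) = Nat.card (twoClassGroup E') := by
  subst h; rfl

theorem main {p q : ℕ} (h : PQ p q) (r : ℕ) (hr : 2 ^ r = 2 * h2 (-((p : ℤ) * q))) (n : ℕ)
    (hn : 1 ≤ n) :
      IsCyclic (twoClassGroup (K (p * q) n)) ∧
      Nonempty ((twoClassGroup (K (p * q) n)) ≃* Multiplicative (ZMod (2 ^ (n + r - 1)))) := by
  have hc : IsCyclic (twoClassGroup (K (p * q) n)) := prim_cyc (two_tors h n)
  refine ⟨hc, ?_⟩
  rw [h2, card_congr_field (quad_eq p q)] at hr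
  obtain ⟨a0, m0, hm0, e0, e0'⟩ := prim_card (G := ClassGroup (𝓞 (K (p * q) 0)))
  obtain ⟨a, m, hm, e, e'⟩ := prim_card (G := ClassGroup (𝓞 (K (p * q) n)))
  obtain ⟨k, hk, ek⟩ := card_K h n
  have hr' : 2 ^ r = 2 * 2 ^ a0 := by rw [← e0]; exact hr
  have hra : r = a0 + 1 := by
    rw [← pow_succ'] at hr'
    exact Nat.pow_right_injective le_rfl hr'
  have haa : a = n + a0 := by
    apply two_pow_odd hm (hk.mul hm0)
    rw [← e', ek, e0', pow_add]; ring
  have hcard : Nat.card (twoClassGroup (K (p * q) n)) = Nat.card (Multiplicative (ZMod (2 ^ (n + r - 1)))) := by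
    rw [Nat.card_congr Multiplicative.toAdd, Nat.card_zmod, hra]
    have : n + (a0 + 1) - 1 = a := by omega
    rw [this]
    exact e
  exact ⟨mulEquivOfCyclicCardEq hcard⟩

theorem main' {p q : ℕ} (h : PQ p q) (r : ℕ) (hr : 2 ^ r = 2 * h2 (-((p : ℤ) * q))) (n : ℕ)
    (hn : 1 ≤ n) (E : IntermediateField ℚ ℂ) (hE : E = K (p * q) n) :
      IsCyclic (twoClassGroup E) ∧
      Nonempty ((twoClassGroup E) ≃* Multiplicative (ZMod (2 ^ (n + r - 1)))) := by
  subst hE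
  exact main h r hr n hn

end TwoCl

/-- for primes `p ≡ 5 (mod 8)`, `q ≡ 3 (mod 8)`, `d = pq` and
`2^r = 2·h₂(-pq)` with `r ≥ 1`: the 2-class group of `K_{n,d}` (the `n`-th layer
of the cyclotomic `ℤ₂`-extension of `ℚ(√-d)`) is cyclic, isomorphic to
`ℤ/2^{n+r-1}ℤ`, for all `n ≥ 1`. -/
theorem twoClassGroup_Kfield_cyclic
    (p q : ℕ) (hp : p.Prime) (hq : q.Prime)
    (hp8 : p % 8 = 5) (hq8 : q % 8 = 3)
    (r : ℕ) (hr1 : 1 ≤ r) (hr : 2 ^ r = 2 * h2 (-((p : ℤ) * q))) :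
    ∀ n : ℕ, 1 ≤ n →
      IsCyclic (twoClassGroup (LplusField n (-((p : ℤ) * q)))) ∧
      Nonempty ((twoClassGroup (LplusField n (-((p : ℤ) * q)))) ≃*
        Multiplicative (ZMod (2 ^ (n + r - 1)))) := by
  intro n hn
  exact TwoCl.main' ⟨hp, hq, hp8, hq8⟩ r hr n hn _ (TwoCl.Lplus_eq p q n)
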